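/- Assume V⁺ ∈ L¹ and assumption (i): ℙ{V(ω,z) ≥ 0} = 1 for all z ∈ R₀ and there exists c ∈ ℝ with ℙ{V(ω,z) ≥ c} = 1 for all z ∈ R∖R₀. Fix a face A ≠ {0} of C₊, let R' = R ∩ A, and assume V⁺(·,z) ∈ L_{z,R'} for each z ∈ R'∖{0} and V⁺(·,0) ∈ L_{ẑ,R'} for some ẑ ∈ R'∖{0}. Then there exists a stochastic process {α(ξ) : ξ ∈ relint A}, nonnegatively homogeneous and subadditive on relint A ℙ-a.s., such that the following holds ℙ-almost surely: for every ξ ∈ relint A and every sequence x_n ∈ G₊ ∩ A with x_n/n → ξ as n → ∞, one has lim_{n→∞} a(0, x_n)/n = α(ξ). -/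

import Mathlib

open MeasureTheory Filter Set
open scoped ENNReal NNReal Classical Topology

noncomputable section

namespace RWRP

abbrev Zd (d : ℕ) := Fin d → ℤ

variable {d : ℕ} {Ω : Type*} {Γ : Type*}

/-- Embedding of `ℤ^d` into `ℝ^d`. -/
def toR (x : Zd d) : Fin d → ℝ := fun i => (x i : ℝ)

/-- The `ℓ¹` norm on `ℝ^d`. -/
def n1 (ξ : Fin d → ℝ) : ℝ := ∑ i, |ξ i|

/-- The `ℓ¹` norm of a lattice point. -/
def n1Z (x : Zd d) : ℝ := n1 (toR x)

/-- `G₊`: the additive semigroup (ℤ₊-combinations) generated by the step set. -/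
def Gp (R : Finset (Zd d)) : Set (Zd d) := {x | ∃ b : Zd d → ℕ, x = ∑ z ∈ R, b z • z}

/-- `G(R')`: the additive group (ℤ-combinations) generated by `R'`. -/
def GZ (R : Finset (Zd d)) : Set (Zd d) := {x | ∃ b : Zd d → ℤ, x = ∑ z ∈ R, b z • z}

/-- ℤ₊-combinations of elements of a set of lattice points. -/
def GpS (S : Set (Zd d)) : Set (Zd d) :=
  {x | ∃ (m : ℕ) (c : Fin m → Zd d), (∀ i, c i ∈ S) ∧ x = ∑ i, c i}

/-- `C₊`: the real cone generated by the step set. -/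
def Cp (R : Finset (Zd d)) : Set (Fin d → ℝ) :=
  {ξ | ∃ b : Zd d → ℝ, (∀ z, 0 ≤ b z) ∧ ξ = ∑ z ∈ R, b z • toR z}

/-- `C'₊`: the rational cone generated by the step set. -/
def CpQ (R : Finset (Zd d)) : Set (Fin d → ℝ) :=
  {ξ | ∃ b : Zd d → ℚ, (∀ z, 0 ≤ b z) ∧ ξ = ∑ z ∈ R, (b z : ℝ) • toR z}

/-- `A` is a face of the convex set `K`. -/
def IsFace (K A : Set (Fin d → ℝ)) : Prop :=
  A ⊆ K ∧ Convex ℝ A ∧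
    ∀ ⦃ξ ζ η : Fin d → ℝ⦄ ⦃t : ℝ⦄, ξ ∈ A → ζ ∈ K → η ∈ K → t ∈ Set.Ioo (0:ℝ) 1 →
      ξ = t • ζ + (1 - t) • η → ζ ∈ A ∧ η ∈ A

/-- `U`: the convex hull of the step set. -/
def hullU (R : Finset (Zd d)) : Set (Fin d → ℝ) := convexHull ℝ (toR '' (R : Set (Zd d)))

/-- `U₀` is the face of `U` containing `0` in its relative interior (the empty set if `0 ∉ U`). -/
def IsZeroFace (R : Finset (Zd d)) (U₀ : Set (Fin d → ℝ)) : Prop :=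
  ((0 : Fin d → ℝ) ∈ hullU R ∧ IsFace (hullU R) U₀ ∧
    (0 : Fin d → ℝ) ∈ intrinsicInterior ℝ U₀) ∨
  ((0 : Fin d → ℝ) ∉ hullU R ∧ U₀ = ∅)

/-- `R₀ = R ∩ U₀`. -/
def R0 (R : Finset (Zd d)) (U₀ : Set (Fin d → ℝ)) : Set (Zd d) := {z | z ∈ R ∧ toR z ∈ U₀}

/-- `A_δ`: the directions in the face `A` at ℓ¹ distance `≥ δ` (after normalization) from the
relative boundary of `A`. -/
def faceDelta (A : Set (Fin d → ℝ)) (δ : ℝ) : Set (Fin d → ℝ) :=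
  {ξ | ξ ∈ A ∧ ξ ≠ 0 ∧
    ENNReal.ofReal δ ≤ ⨅ (η : Fin d → ℝ) (_ : η ∈ A \ intrinsicInterior ℝ A),
      ENNReal.ofReal (n1 ((n1 ξ)⁻¹ • ξ - η))}

/-- `U'_δ = {ξ ∈ U' : dist(ξ, U' ∖ relint Uall) ≥ δ}`. -/
def faceDeltaU (Uall U' : Set (Fin d → ℝ)) (δ : ℝ) : Set (Fin d → ℝ) :=
  {ξ | ξ ∈ U' ∧
    ENNReal.ofReal δ ≤ ⨅ (η : Fin d → ℝ) (_ : η ∈ U' \ intrinsicInterior ℝ Uall),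
      ENNReal.ofReal (n1 (ξ - η))}

/-- `D_n`: points reachable in exactly `n` admissible steps (counted with multiplicities). -/
def Dn (R : Finset (Zd d)) (n : ℕ) : Set (Zd d) :=
  {x | ∃ b : Zd d → ℕ, (∑ z ∈ R, b z) = n ∧ x = ∑ z ∈ R, b z • z}

/-- Position after `k` steps of the path with increments `f`, started at `x`. -/
def pos (x : Zd d) (f : ℕ → Zd d) (k : ℕ) : Zd d := x + ∑ i ∈ Finset.range k, f i

/-- Convert a finite tuple of admissible steps to an increment sequence. -/
def stepF {R : Finset (Zd d)} (n : ℕ) (s : Fin n → {z : Zd d // z ∈ R}) : ℕ → Zd d :=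
  fun i => if h : i < n then (s ⟨i, h⟩ : Zd d) else 0

/-- The path started at `x` with increments `f` hits `y` for the first time (after time `0`)
at time `n`. -/
def firstHit (x y : Zd d) (n : ℕ) (f : ℕ → Zd d) : Prop :=
  pos x f n = y ∧ ∀ k ∈ Finset.Ioo 0 n, pos x f k ≠ y

/-- Probability weight of a tuple of steps under the random walk kernel `p`. -/
def pathW (p : Zd d → ℝ) {R : Finset (Zd d)} {n : ℕ} (s : Fin n → {z : Zd d // z ∈ R}) : ℝ≥0∞ :=
  ∏ i, ENNReal.ofReal (p (s i : Zd d))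

/-- Total potential collected along the first `n` steps of a path. -/
def pathV (T : Zd d → Ω → Ω) (V : Ω → Zd d → ℝ) (ω : Ω) (x : Zd d) (n : ℕ)
    (f : ℕ → Zd d) : ℝ :=
  ∑ i ∈ Finset.range n, V (T (pos x f i) ω) (f i)

/-- `E_x[exp(-∑_{k<τ_y} V(T_{X_k}ω, Z_{k+1})) 1{τ_y < ∞}]`, as a sum over killed paths. -/
def walkK (T : Zd d → Ω → Ω) (V : Ω → Zd d → ℝ) (p : Zd d → ℝ) (R : Finset (Zd d))
    (ω : Ω) (x y : Zd d) : ℝ≥0∞ :=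
  ∑' n : ℕ, ∑ s : Fin (n+1) → {z : Zd d // z ∈ R},
    if firstHit x y (n+1) (stepF (n+1) s) then
      pathW p s * ENNReal.ofReal (Real.exp (-(pathV T V ω x (n+1) (stepF (n+1) s))))
    else 0

/-- The point-to-point quantity `a(ω,x,y)` (real-valued version, with junk values where the
underlying expectation is `0` or `∞`). -/
def aFun (T : Zd d → Ω → Ω) (V : Ω → Zd d → ℝ) (p : Zd d → ℝ) (R : Finset (Zd d))
    (ω : Ω) (x y : Zd d) : ℝ :=
  if y = x then 0 else - Real.log ((walkK T V p R ω x y).toReal)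

/-- The point-to-point quantity `a(ω,x,y)` with values in `[-∞,∞]`. -/
def aE (T : Zd d → Ω → Ω) (V : Ω → Zd d → ℝ) (p : Zd d → ℝ) (R : Finset (Zd d))
    (ω : Ω) (x y : Zd d) : EReal :=
  if y = x then (0 : EReal) else - (ENNReal.log (walkK T V p R ω x y))

/-- The zero-temperature quantity `a_∞(ω,x,y)`: the infimum of the total potential over
admissible paths from `x` to `y` that hit `y` for the first time at their last step. -/
def aInf (T : Zd d → Ω → Ω) (V : Ω → Zd d → ℝ) (R : Finset (Zd d))
    (ω : Ω) (x y : Zd d) : ℝ :=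
  if y = x then 0 else
    sInf {v : ℝ | ∃ n : ℕ, ∃ s : Fin (n+1) → {z : Zd d // z ∈ R},
      firstHit x y (n+1) (stepF (n+1) s) ∧ v = pathV T V ω x (n+1) (stepF (n+1) s)}

/-- The Green's function `g(ω,x,y)`, with values in `[0,∞]`. -/
def greenK (T : Zd d → Ω → Ω) (V : Ω → Zd d → ℝ) (p : Zd d → ℝ) (R : Finset (Zd d))
    (ω : Ω) (x y : Zd d) : ℝ≥0∞ :=
  (if y = x then 1 else 0) +
  ∑' n : ℕ, ∑ s : Fin (n+1) → {z : Zd d // z ∈ R},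
    if pos x (stepF (n+1) s) (n+1) = y then
      pathW p s * ENNReal.ofReal (Real.exp (-(pathV T V ω x (n+1) (stepF (n+1) s))))
    else 0

/-- `E_x[exp(-∑_{k<n} V) 1{X_n = y}]`: the restricted-length partition function. -/
def resK (T : Zd d → Ω → Ω) (V : Ω → Zd d → ℝ) (p : Zd d → ℝ) (R : Finset (Zd d))
    (ω : Ω) (n : ℕ) (x y : Zd d) : ℝ≥0∞ :=
  ∑ s : Fin n → {z : Zd d // z ∈ R},
    if pos x (stepF n s) n = y then
      pathW p s * ENNReal.ofReal (Real.exp (-(pathV T V ω x n (stepF n s))))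
    else 0

/-- `G_{x,(n),y} = log E_x[exp(-∑_{k<n} V) 1{X_n = y}]`. -/
def GRes (T : Zd d → Ω → Ω) (V : Ω → Zd d → ℝ) (p : Zd d → ℝ) (R : Finset (Zd d))
    (ω : Ω) (n : ℕ) (x y : Zd d) : ℝ :=
  Real.log ((resK T V p R ω n x y).toReal)

/-- The return probability `P₀(τ₀ < ∞)` of the reference walk. -/
def retP (p : Zd d → ℝ) (R : Finset (Zd d)) : ℝ≥0∞ :=
  ∑' n : ℕ, ∑ s : Fin (n+1) → {z : Zd d // z ∈ R},
    if firstHit (0 : Zd d) 0 (n+1) (stepF (n+1) s) then pathW p s else 0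

/-- `R_ε`: the ℓ¹-distance from the origin to the nearest point `x` of `G₊(S)` with
`V(T_x ω, z) ≥ ε` for some `z ∈ S`, as an element of `[0,∞]`. -/
def Reps (T : Zd d → Ω → Ω) (V : Ω → Zd d → ℝ) (S : Set (Zd d)) (ε : ℝ) (ω : Ω) : ℝ≥0∞ :=
  ⨅ (x : Zd d) (_ : x ∈ GpS S ∧ ∃ z ∈ S, ε ≤ V (T x ω) z), ENNReal.ofReal (n1Z x)

/-- The shift maps on a product space. -/
def shiftT (z : Zd d) (ω : Zd d → Γ) : Zd d → Γ := fun y => ω (z + y)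

/-- A function is locally Lipschitz (w.r.t. the ℓ¹ norm) on a set. -/
def LocLipOn (f : (Fin d → ℝ) → ℝ) (S : Set (Fin d → ℝ)) : Prop :=
  ∀ ξ ∈ S, ∃ K ε : ℝ, 0 < ε ∧ ∀ x ∈ S, ∀ y ∈ S,
    n1 (x - ξ) < ε → n1 (y - ξ) < ε → |f x - f y| ≤ K * n1 (x - y)

section measurable

variable [MeasurableSpace Ω]

/-- The σ-algebra of measurable sets invariant under the shifts `{T_z : z ∈ S}`. -/
def invSigma (T : Zd d → Ω → Ω) (S : Set (Zd d)) : MeasurableSpace Ω where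
  MeasurableSet' A := MeasurableSet A ∧ ∀ z ∈ S, T z ⁻¹' A = A
  measurableSet_empty := ⟨MeasurableSet.empty, fun _ _ => by simp⟩
  measurableSet_compl A hA := ⟨hA.1.compl, fun z hz => by
    rw [Set.preimage_compl, hA.2 z hz]⟩
  measurableSet_iUnion f hf := ⟨MeasurableSet.iUnion fun i => (hf i).1, fun z hz => by
    rw [Set.preimage_iUnion]
    exact Set.iUnion_congr fun i => (hf i).2 z hz⟩

/-- `ℙ` is ergodic under the shifts `{T_z : z ∈ S}`. -/
def ErgodicUnder (ℙ : Measure Ω) (T : Zd d → Ω → Ω) (S : Set (Zd d)) : Prop :=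
  ∀ A : Set Ω, MeasurableSet A → (∀ z ∈ S, T z ⁻¹' A = A) → ℙ A = 0 ∨ ℙ A = 1

/-- The class `𝓛_{z,R'}`. -/
def classL (ℙ : Measure Ω) (T : Zd d → Ω → Ω) (g : Ω → ℝ) (z : Zd d)
    (R' : Finset (Zd d)) : Prop :=
  ∀ᵐ ω ∂ℙ,
    (⨅ ε : {e : ℝ // 0 < e},
      Filter.limsup (fun n : ℕ =>
        ⨆ (x : Zd d) (_ : x ∈ Gp R' ∧ n1Z x ≤ n),
          (n : ℝ≥0∞)⁻¹ *
            ∑ k ∈ Finset.range (⌊(ε : ℝ) * n⌋₊ + 1), ENNReal.ofReal (g (T (x + k • z) ω)))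
        Filter.atTop) = 0

/-- Extended conditional expectation, with values in `[-∞,∞]`: the decreasing limit of the
conditional expectations of the truncations `max f (-n)`.  It agrees a.s. with the usual
conditional expectation in `[-∞,∞)` whenever `f⁺` is integrable. -/
def condExpE (ℙ : Measure Ω) (m : MeasurableSpace Ω) (f : Ω → ℝ) : Ω → EReal :=
  fun ω => ⨅ n : ℕ, ((MeasureTheory.condExp m ℙ (fun ω' => max (f ω') (-(n : ℝ))) ω : ℝ) : EReal)

/-- `EReal → ℝ≥0∞`, sending `[-∞,0]` to `0` and `⊤` to `⊤`. -/
def erealToENN (x : EReal) : ℝ≥0∞ := if x = ⊤ then ⊤ else ENNReal.ofReal x.toReal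

/-- `ᾱ(x) = inf_{n ≥ 1} (1/n) E[a(0,nx) | I_x]`, with `ᾱ(0) = 0`. -/
def alphaBar (ℙ : Measure Ω) (T : Zd d → Ω → Ω) (V : Ω → Zd d → ℝ) (p : Zd d → ℝ)
    (R : Finset (Zd d)) (x : Zd d) : Ω → EReal :=
  fun ω =>
    if x = 0 then 0 else
    ⨅ n : {m : ℕ // 0 < m},
      (((n : ℕ) : ℝ)⁻¹ : EReal) *
        condExpE ℙ (invSigma T {x}) (fun ω' => aFun T V p R ω' 0 ((n : ℕ) • x)) ω

/-- `x̂_t(ξ) = ∑_z ⌊tγ_z⌋ z`. -/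
def xhat (R : Finset (Zd d)) (γ : Zd d → ℝ) (t : ℝ) : Zd d := ∑ z ∈ R, ⌊t * γ z⌋ • z

/-- `tilde-α(ξ) = inf_{t ∈ ℚ, t>0} (1/t) E[a(0, x̂_t(ξ)) | 𝔖]`, where `𝔖` is the σ-algebra of
sets invariant under the shifts from `S`. -/
def tAlpha (ℙ : Measure Ω) (T : Zd d → Ω → Ω) (V : Ω → Zd d → ℝ) (p : Zd d → ℝ)
    (R : Finset (Zd d)) (S : Set (Zd d)) (γ : Zd d → ℝ) : Ω → EReal :=
  fun ω => ⨅ t : {q : ℚ // 0 < q},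
    ((((t : ℚ) : ℝ))⁻¹ : EReal) *
      condExpE ℙ (invSigma T S) (fun ω' => aFun T V p R ω' 0 (xhat R γ ((t : ℚ) : ℝ))) ω

/-- The σ-algebra `𝔖_ξ` of sets invariant under the shifts from `R_ξ = R ∩ C_ξ`. -/
def Sface (T : Zd d → Ω → Ω) (R : Finset (Zd d))
    (Cface : (Fin d → ℝ) → Set (Fin d → ℝ)) (ξ : Fin d → ℝ) : MeasurableSpace Ω :=
  invSigma T {z | z ∈ R ∧ toR z ∈ Cface ξ}

/-- `tilde-α` as a function of the direction `ξ`, given a choice `Cface` of the face `C_ξ`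
and a choice `γfun` of cone coefficients. -/
def tAlphaF (ℙ : Measure Ω) (T : Zd d → Ω → Ω) (V : Ω → Zd d → ℝ) (p : Zd d → ℝ)
    (R : Finset (Zd d)) (Cface : (Fin d → ℝ) → Set (Fin d → ℝ))
    (γfun : (Fin d → ℝ) → Zd d → ℝ) (ξ : Fin d → ℝ) : Ω → EReal :=
  fun ω => if ξ = 0 then 0 else tAlpha ℙ T V p R {z | z ∈ R ∧ toR z ∈ Cface ξ} (γfun ξ) ω

/-- `B` is an `L¹` covariant cocycle on the group generated by the allowed steps. -/
def IsCocycle (ℙ : Measure Ω) (T : Zd d → Ω → Ω) (S : Set (Zd d))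
    (B : Ω → Zd d → Zd d → ℝ) : Prop :=
  (∀ x y : Zd d, Measurable fun ω => B ω x y) ∧
  (∀ x ∈ S, ∀ y ∈ S, Integrable (fun ω => B ω x y) ℙ) ∧
  (∀ᵐ ω ∂ℙ, ∀ x ∈ S, ∀ y ∈ S, ∀ z ∈ S, B ω x y + B ω y z = B ω x z) ∧
  (∀ᵐ ω ∂ℙ, ∀ x ∈ S, ∀ y ∈ S, ∀ z ∈ S, B ω (x + z) (y + z) = B (T z ω) x y)

/-- The class `K⁺_A(V)` of centered cocycles. -/
def InKplus (ℙ : Measure Ω) (T : Zd d → Ω → Ω) (V : Ω → Zd d → ℝ) (p : Zd d → ℝ)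
    (R' : Finset (Zd d)) (B : Ω → Zd d → Zd d → ℝ) : Prop :=
  IsCocycle ℙ T (GZ R') B ∧
  ∀ᵐ ω ∂ℙ, ∑ z ∈ R', p z * Real.exp (-(V ω z) - B ω 0 z) ≤ 1

/-- The standing setting: shifts, stationary `ℙ`, finite step set, measurable potential,
random walk kernel. -/
def Setting (ℙ : Measure Ω) (T : Zd d → Ω → Ω) (R : Finset (Zd d))
    (V : Ω → Zd d → ℝ) (p : Zd d → ℝ) : Prop :=
  (∀ z : Zd d, Measurable (T z)) ∧ T 0 = id ∧ (∀ x y : Zd d, T (x + y) = T x ∘ T y) ∧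
  (∀ z : Zd d, MeasurePreserving (T z) ℙ ℙ) ∧ 2 ≤ R.card ∧
  (∀ z : Zd d, Measurable fun ω => V ω z) ∧
  (∀ z ∈ R, 0 < p z ∧ p z < 1) ∧ ∑ z ∈ R, p z = 1

/-- `V⁺ ∈ L¹`. -/
def VplusL1 (ℙ : Measure Ω) (V : Ω → Zd d → ℝ) (R : Finset (Zd d)) : Prop :=
  ∀ z ∈ R, Integrable (fun ω => max (V ω z) 0) ℙ

/-- Assumption (i): `V ≥ 0` a.s. on `R₀` and `V ≥ c` a.s. on `R ∖ R₀`. -/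
def AssumptionI (ℙ : Measure Ω) (V : Ω → Zd d → ℝ) (R : Finset (Zd d))
    (U₀ : Set (Fin d → ℝ)) : Prop :=
  (∀ z ∈ R0 R U₀, ∀ᵐ ω ∂ℙ, 0 ≤ V ω z) ∧
  ∃ c : ℝ, ∀ z ∈ R, toR z ∉ U₀ → ∀ᵐ ω ∂ℙ, c ≤ V ω z

end measurable

end RWRP



open MeasureTheory Filter Set
open scoped ENNReal NNReal Classical Topology
noncomputable section
set_option linter.unusedSectionVars false
namespace RWRPerg

lemma greedy_max (E : ℕ → Prop) (G : ℕ → ℝ≥0∞) (lam : ℝ≥0∞) (M : ℕ)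
    (h : ∀ k, E k → ∃ n, 1 ≤ n ∧ n ≤ M ∧ lam * (n:ℝ≥0∞) ≤ ∑ j ∈ Finset.range n, G (k+j)) :
    ∀ L k, lam * ∑ j ∈ Finset.range L, (if E (k+j) then (1:ℝ≥0∞) else 0) ≤
      ∑ j ∈ Finset.range (L+M), G (k+j) := by
  intro L
  induction L using Nat.strong_induction_on with
  | _ L ih =>
    intro k
    by_cases hE : E k
    · obtain ⟨n, hn1, hnM, hn⟩ := h k hE
      by_cases hL : L ≤ n
      · calc lam * ∑ j ∈ Finset.range L, (if E (k+j) then (1:ℝ≥0∞) else 0)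
            ≤ lam * ∑ j ∈ Finset.range L, (1:ℝ≥0∞) := by
              gcongr; split_ifs <;> simp
          _ ≤ lam * (n:ℝ≥0∞) := by
              gcongr; simp [hL]
          _ ≤ _ := hn
          _ ≤ _ := by
              apply Finset.sum_le_sum_of_subset
              intro j hj
              simp only [Finset.mem_range] at *
              omega
      · obtain ⟨L2, rfl⟩ := Nat.exists_eq_add_of_le (le_of_not_ge hL)
        have h2 := ih L2 (by omega) (k+n)
        rw [Finset.sum_range_add, mul_add, add_assoc, Finset.sum_range_add]
        refine add_le_add ?_ ?_
        · refine le_trans ?_ hn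
          gcongr
          calc _ ≤ ∑ j ∈ Finset.range n, (1:ℝ≥0∞) := by
                apply Finset.sum_le_sum; intro j _; split_ifs <;> simp
            _ = n := by simp
        · simpa [add_assoc] using h2
    · cases L with
      | zero => simp
      | succ L =>
        have h2 := ih L (by omega) (k+1)
        rw [Finset.sum_range_succ', show L + 1 + M = (L + M) + 1 by ring, Finset.sum_range_succ']
        simp only [add_zero, hE, if_false]
        refine le_trans ?_ le_self_add
        refine le_trans (le_of_eq ?_) (le_trans h2 (le_of_eq ?_))
        · congr 1; apply Finset.sum_congr rfl; intro j _; rw [show k + (j+1) = k+1+j by ring]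
        · apply Finset.sum_congr rfl; intro j _; rw [show k + (j+1) = k+1+j by ring]

lemma greedy_king (F : ℕ → ℕ → ℝ≥0∞) (G : ℕ → ℝ≥0∞) (c : ℝ≥0∞) (N : ℕ)
    (h0 : ∀ k, F k 0 = 0)
    (hsub : ∀ k m n, F k (m+n) ≤ F k m + F (k+m) n)
    (h1 : ∀ k, F k 1 ≤ N + G k)
    (h2 : ∀ k, F k 1 ≤ G k ∨ ∃ l, 1 ≤ l ∧ l ≤ N ∧ F k l ≤ l * c) :
    ∀ n k, F k n ≤ n * c + ∑ j ∈ Finset.range n, G (k+j) + (N:ℝ≥0∞) * N := by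
  have hs : ∀ n k, F k n ≤ ∑ j ∈ Finset.range n, (N + G (k+j)) := by
    intro n
    induction n with
    | zero => intro k; simp [h0]
    | succ n ih =>
      intro k
      rw [Finset.sum_range_succ]
      exact (hsub k n 1).trans (add_le_add (ih k) (h1 _))
  intro n
  induction n using Nat.strong_induction_on with
  | _ n ih =>
    intro k
    by_cases hn : n ≤ N
    · refine (hs n k).trans ?_
      rw [Finset.sum_add_distrib]
      have : ∑ j ∈ Finset.range n, (N:ℝ≥0∞) ≤ (N:ℝ≥0∞) * N := by
        simp only [Finset.sum_const, Finset.card_range, nsmul_eq_mul]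
        gcongr
      calc _ ≤ (N:ℝ≥0∞) * N + ∑ j ∈ Finset.range n, G (k+j) := by gcongr
        _ = ∑ j ∈ Finset.range n, G (k+j) + (N:ℝ≥0∞) * N := add_comm _ _
        _ ≤ _ := by gcongr; exact le_add_self
    · rcases h2 k with hb | ⟨l, hl1, hlN, hl⟩
      · obtain ⟨m, rfl⟩ : ∃ m, n = 1 + m := ⟨n-1, by omega⟩
        have := ih m (by omega) (k+1)
        rw [Finset.sum_range_add]
        calc F k (1+m) ≤ F k 1 + F (k+1) m := hsub _ _ _
          _ ≤ G k + (m * c + ∑ j ∈ Finset.range m, G (k+1+j) + (N:ℝ≥0∞) * N) := add_le_add hb this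
          _ ≤ ((1+m : ℕ):ℝ≥0∞) * c + (∑ j ∈ Finset.range 1, G (k+j) + ∑ j ∈ Finset.range m, G (k+(1+j))) + (N:ℝ≥0∞) * N := by
            simp only [Finset.sum_range_one, add_zero, ← add_assoc]
            gcongr ?_ + _
            rw [add_comm (G k)]
            gcongr ?_ * _ + _ + _
            push_cast; exact le_add_self
      · obtain ⟨m, rfl⟩ := Nat.exists_eq_add_of_le (show l ≤ n by omega)
        have := ih m (by omega) (k+l)
        rw [Finset.sum_range_add]
        calc F k (l+m) ≤ F k l + F (k+l) m := hsub _ _ _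
          _ ≤ l * c + (m * c + ∑ j ∈ Finset.range m, G (k+l+j) + (N:ℝ≥0∞) * N) := add_le_add hl this
          _ ≤ ((l+m : ℕ):ℝ≥0∞) * c + (∑ j ∈ Finset.range l, G (k+j) + ∑ j ∈ Finset.range m, G (k+(l+j))) + (N:ℝ≥0∞) * N := by
            simp only [← add_assoc]
            gcongr ?_ + _
            push_cast
            rw [add_mul]
            gcongr ?_ + _
            exact le_self_add

variable {Ω : Type*} [MeasurableSpace Ω] {μ : Measure Ω} [IsProbabilityMeasure μ] {T : Ω → Ω}

lemma maximal_fin (hT : MeasurePreserving T μ μ) {g : Ω → ℝ≥0∞} (hg : Measurable g)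
    (lam : ℝ≥0∞) (hlam : lam ≠ ∞) (M : ℕ) :
    lam * μ {x | ∃ n : ℕ, 1 ≤ n ∧ n ≤ M ∧ lam * (n:ℝ≥0∞) ≤ ∑ j ∈ Finset.range n, g (T^[j] x)} ≤ ∫⁻ x, g x ∂μ := by
  set E := {x | ∃ n : ℕ, 1 ≤ n ∧ n ≤ M ∧ lam * (n:ℝ≥0∞) ≤ ∑ j ∈ Finset.range n, g (T^[j] x)} with hE
  have hTm : ∀ j, Measurable (T^[j]) := fun j => hT.measurable.iterate j
  have hEm : MeasurableSet E := by
    have : E = ⋃ n ∈ Finset.Icc 1 M, {x | lam * (n:ℝ≥0∞) ≤ ∑ j ∈ Finset.range n, g (T^[j] x)} := by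
      ext x; simp [hE, and_assoc]
    rw [this]
    refine Finset.measurableSet_biUnion _ fun n _ => ?_
    exact measurableSet_le measurable_const
      (Finset.measurable_sum _ fun j _ => hg.comp (hTm j))
  by_cases hI : ∫⁻ x, g x ∂μ = ∞
  · rw [hI]; exact le_top
  have key : ∀ L : ℕ, (L:ℝ≥0∞) * (lam * μ E) ≤ ((L + M : ℕ):ℝ≥0∞) * ∫⁻ x, g x ∂μ := by
    intro L
    have h1 : ∫⁻ x, lam * ∑ j ∈ Finset.range L, (if T^[j] x ∈ E then (1:ℝ≥0∞) else 0) ∂μ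
        ≤ ∫⁻ x, ∑ j ∈ Finset.range (L+M), g (T^[j] x) ∂μ := by
      apply lintegral_mono
      intro x
      have := greedy_max (fun k => T^[k] x ∈ E) (fun k => g (T^[k] x)) lam M ?_ L 0
      · simpa using this
      · rintro k ⟨n, h1, h2, h3⟩
        refine ⟨n, h1, h2, h3.trans (le_of_eq ?_)⟩
        apply Finset.sum_congr rfl; intro j _
        rw [← Function.iterate_add_apply, add_comm]
    have hind : ∀ j, Measurable fun x => (if T^[j] x ∈ E then (1:ℝ≥0∞) else 0) := fun j =>
      Measurable.ite ((hTm j) hEm) measurable_const measurable_const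
    rw [lintegral_const_mul _ (Finset.measurable_sum _ fun j _ => hind j),
      lintegral_finsetSum _ (fun j _ => hind j),
      lintegral_finsetSum (f := fun j x => g (T^[j] x)) _ (fun j _ => hg.comp (hTm j))] at h1
    have h2 : ∀ j, ∫⁻ x, (if T^[j] x ∈ E then (1:ℝ≥0∞) else 0) ∂μ = μ E := by
      intro j
      have : (fun x => (if T^[j] x ∈ E then (1:ℝ≥0∞) else 0)) = (T^[j] ⁻¹' E).indicator 1 := by
        ext x; simp [Set.indicator]
      rw [this, lintegral_indicator_one ((hTm j) hEm), (hT.iterate j).measure_preimage hEm.nullMeasurableSet]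
    have h3 : ∀ j, ∫⁻ x, g (T^[j] x) ∂μ = ∫⁻ x, g x ∂μ := fun j =>
      (hT.iterate j).lintegral_comp hg
    simp only [h2, h3, Finset.sum_const, Finset.card_range, nsmul_eq_mul] at h1
    rw [mul_left_comm]; exact h1
  have ha : lam * μ E ≠ ∞ := ENNReal.mul_ne_top hlam (measure_ne_top _ _)
  lift lam * μ E to ℝ≥0 using ha with a
  lift ∫⁻ x, g x ∂μ to ℝ≥0 using hI with I
  have key2 : ∀ L : ℕ, (L:ℝ) * a ≤ (L + M) * I := fun L => by
    have := key L; norm_cast at this; exact_mod_cast this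
  norm_cast
  by_contra hlt
  push Not at hlt
  have hlt' : (I:ℝ) < a := by exact_mod_cast hlt
  obtain ⟨L, hL⟩ := exists_nat_gt ((M * I : ℝ) / (a - I))
  rw [div_lt_iff₀ (by linarith)] at hL
  have := key2 L
  linarith

lemma maximal (hT : MeasurePreserving T μ μ) {g : Ω → ℝ≥0∞} (hg : Measurable g)
    (lam : ℝ≥0∞) (hlam : lam ≠ ∞) :
    lam * μ {x | ∃ n : ℕ, 1 ≤ n ∧ lam * (n:ℝ≥0∞) ≤ ∑ j ∈ Finset.range n, g (T^[j] x)} ≤ ∫⁻ x, g x ∂μ := by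
  have : {x | ∃ n : ℕ, 1 ≤ n ∧ lam * (n:ℝ≥0∞) ≤ ∑ j ∈ Finset.range n, g (T^[j] x)} =
      ⋃ M : ℕ, {x | ∃ n : ℕ, 1 ≤ n ∧ n ≤ M ∧ lam * (n:ℝ≥0∞) ≤ ∑ j ∈ Finset.range n, g (T^[j] x)} := by
    ext x; simp only [mem_ofPred_eq, mem_iUnion]
    exact ⟨fun ⟨n, h1, h2⟩ => ⟨n, n, h1, le_rfl, h2⟩, fun ⟨_, n, h1, _, h2⟩ => ⟨n, h1, h2⟩⟩
  rw [this, Monotone.measure_iUnion, ENNReal.mul_iSup]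
  · exact iSup_le fun M => maximal_fin hT hg lam hlam M
  · intro M M' hM x ⟨n, h1, h2, h3⟩
    exact ⟨n, h1, h2.trans hM, h3⟩

lemma vanish (hT : MeasurePreserving T μ μ) {g : ℕ → Ω → ℝ≥0∞} (hg : ∀ K, Measurable (g K))
    {h : Ω → ℝ≥0∞} (hle : ∀ K x, g K x ≤ h x) (hh : ∫⁻ x, h x ∂μ ≠ ∞)
    (hlim : ∀ᵐ x ∂μ, Tendsto (fun K => g K x) atTop (𝓝 0)) (lam : ℝ≥0∞) (hlam : lam ≠ ∞)
    (hlam0 : lam ≠ 0) :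
    ∀ᵐ x ∂μ, ∃ K, ∀ n, 1 ≤ n → ∑ j ∈ Finset.range n, g K (T^[j] x) ≤ lam * (n:ℝ≥0∞) := by
  have hint : Tendsto (fun K => ∫⁻ x, g K x ∂μ) atTop (𝓝 0) := by
    have := tendsto_lintegral_of_dominated_convergence (μ := μ) (F := g) (f := fun _ => 0) h hg
      (fun K => ae_of_all _ (hle K)) hh hlim
    simpa using this
  rw [ae_iff]
  set B := {x | ¬ ∃ K, ∀ n, 1 ≤ n → ∑ j ∈ Finset.range n, g K (T^[j] x) ≤ lam * (n:ℝ≥0∞)}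
  have hB : ∀ K, lam * μ B ≤ ∫⁻ x, g K x ∂μ := by
    intro K
    refine le_trans ?_ (maximal hT (hg K) lam hlam)
    gcongr
    intro x hx
    simp only [B, mem_ofPred_eq] at hx
    push Not at hx
    obtain ⟨n, h1, h2⟩ := hx K
    exact ⟨n, h1, h2.le⟩
  have : lam * μ B ≤ 0 := ge_of_tendsto' hint hB
  simpa [hlam0] using this

lemma inv_ae (hT : MeasurePreserving T μ μ) {F : Ω → ℝ≥0∞} (hF : Measurable F)
    (hle : ∀ᵐ x ∂μ, F x ≤ F (T x)) : ∀ᵐ x ∂μ, F (T x) = F x := by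
  have h1 : ∀ q : ℚ, ∀ᵐ x ∂μ, ((Real.toNNReal q : ℝ≥0∞) < F (T x) → (Real.toNNReal q : ℝ≥0∞) < F x) := by
    intro q
    have hm : MeasurableSet {x | (Real.toNNReal q : ℝ≥0∞) < F x} := measurableSet_lt measurable_const hF
    have : {x | (Real.toNNReal q : ℝ≥0∞) < F x} =ᵐ[μ] T ⁻¹' {x | (Real.toNNReal q : ℝ≥0∞) < F x} := by
      apply ae_eq_of_ae_subset_of_measure_ge
      · filter_upwards [hle] with x hx
        intro hx2
        exact lt_of_lt_of_le hx2 hx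
      · exact (hT.measure_preimage hm.nullMeasurableSet).le
      · exact hm.nullMeasurableSet
      · exact measure_ne_top _ _
    filter_upwards [this.mem_iff] with x hx hx2
    exact hx.2 hx2
  rw [← ae_all_iff] at h1
  filter_upwards [h1, hle] with x hx hx2
  refine le_antisymm ?_ hx2
  by_contra hlt
  push Not at hlt
  obtain ⟨q, _, hq1, hq2⟩ := ENNReal.lt_iff_exists_rat_btwn.1 hlt
  exact absurd (hx q hq2) (not_lt.2 hq1.le)

lemma ae_orbit (hT : MeasurePreserving T μ μ) {P : Ω → Prop} (h : ∀ᵐ x ∂μ, P x) :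
    ∀ᵐ x ∂μ, ∀ k : ℕ, P (T^[k] x) :=
  ae_all_iff.2 fun k => (hT.iterate k).quasiMeasurePreserving.ae h


section king
variable {f : ℕ → Ω → ℝ≥0∞}

def Fl (f : ℕ → Ω → ℝ≥0∞) (x : Ω) : ℝ≥0∞ := liminf (fun n : ℕ => f n x / n) atTop

lemma Fl_meas (hf : ∀ n, Measurable (f n)) : Measurable (Fl f) :=
  Measurable.liminf fun n => (hf n).div_const _

lemma Fl_mono (hfin : f 1 x₀ ≠ ∞) (hs : ∀ n, f (1+n) x₀ ≤ f 1 x₀ + f n y₀) : Fl f x₀ ≤ Fl f y₀ := by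
  refine le_of_forall_gt_imp_ge_of_dense fun c hc => ?_
  obtain ⟨c', hc1, hc2⟩ := exists_between hc
  have hfr : ∃ᶠ n : ℕ in atTop, f n y₀ / n < c' :=
    frequently_lt_of_liminf_lt (by isBoundedDefault) hc1
  have hev : ∀ᶠ n : ℕ in atTop, f 1 x₀ / n < c - c' := by
    have : Tendsto (fun n : ℕ => f 1 x₀ / (n:ℝ≥0∞)) atTop (𝓝 0) := by
      have := ENNReal.Tendsto.const_div (a := f 1 x₀) ENNReal.tendsto_nat_nhds_top (Or.inr hfin)
      simpa using this
    exact this.eventually (gt_mem_nhds (tsub_pos_of_lt hc2))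
  unfold Fl
  rw [← liminf_nat_add _ 1]
  apply liminf_le_of_frequently_le'
  refine (hfr.and_eventually (hev.and (eventually_ge_atTop 1))).mono ?_
  rintro n ⟨h1, h2, h3⟩
  calc f (n+1) x₀ / ((n+1 : ℕ):ℝ≥0∞) ≤ (f 1 x₀ + f n y₀) / (n:ℝ≥0∞) := by
        rw [add_comm n 1]
        gcongr
        · exact hs n
        · simp
    _ = f 1 x₀ / n + f n y₀ / n := ENNReal.add_div
    _ ≤ (c - c') + c' := add_le_add h2.le h1.le
    _ = c := tsub_add_cancel_of_le hc2.le

theorem kingman (hT : MeasurePreserving T μ μ) (hf : ∀ n, Measurable (f n))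
    (h0 : ∀ x, f 0 x = 0)
    (hsub : ∀ᵐ x ∂μ, ∀ m n, f (m+n) x ≤ f m x + f n (T^[m] x))
    (hint : ∫⁻ x, f 1 x ∂μ ≠ ∞) :
    ∀ᵐ x ∂μ, Fl f x ≠ ∞ ∧ limsup (fun n : ℕ => f n x / n) atTop ≤ Fl f x := by
  have hfin : ∀ᵐ x ∂μ, f 1 x ≠ ∞ := by
    filter_upwards [ae_lt_top (hf 1) hint] with x hx using hx.ne
  have hFinv : ∀ᵐ x ∂μ, Fl f (T x) = Fl f x := by
    apply inv_ae hT (Fl_meas hf)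
    filter_upwards [hfin, hsub] with x hx hs
    exact Fl_mono hx fun n => by simpa using hs 1 n
  have hTm : ∀ j, Measurable (T^[j]) := fun j => hT.measurable.iterate j
  have hsubo := ae_orbit hT hsub
  -- finiteness
  have hFfin : ∀ᵐ x ∂μ, Fl f x ≠ ∞ := by
    have hv := vanish hT (g := fun K x => if (K:ℝ≥0∞) < f 1 x then f 1 x else 0)
      (fun K => Measurable.ite (measurableSet_lt measurable_const (hf 1)) (hf 1) measurable_const)
      (h := f 1) (fun K x => by split_ifs <;> simp) hint ?_ 1 (by simp) (by simp)
    · filter_upwards [hv, hsubo] with x ⟨K, hK⟩ hs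
      have hb : ∀ n : ℕ, f n x ≤ ∑ j ∈ Finset.range n, ((K:ℝ≥0∞) + (if (K:ℝ≥0∞) < f 1 (T^[j] x) then f 1 (T^[j] x) else 0)) := by
        intro n
        induction n with
        | zero => simp [h0]
        | succ n ih =>
          rw [Finset.sum_range_succ]
          refine (by simpa using hs 0 n 1 : f (n+1) x ≤ _).trans (add_le_add ih ?_)
          split_ifs with h
          · exact le_add_self
          · simpa using h
      have : Fl f x ≤ K + 1 := by
        apply liminf_le_of_frequently_le'
        refine Eventually.frequently ?_
        filter_upwards [eventually_ge_atTop 1] with n hn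
        apply ENNReal.div_le_of_le_mul
        refine (hb n).trans ?_
        rw [Finset.sum_add_distrib, add_mul]
        refine add_le_add (by simp [mul_comm]) (hK n hn)
      exact ne_top_of_le_ne_top (by simp) this
    · filter_upwards [hfin] with x hx
      obtain ⟨K0, hK0⟩ := ENNReal.exists_nat_gt hx
      apply tendsto_const_nhds.congr'
      filter_upwards [eventually_ge_atTop K0] with K hK
      rw [if_neg]
      rw [not_lt]
      exact hK0.le.trans (by exact_mod_cast hK)
  have hFo := ae_orbit hT hFinv
  have main : ∀ i : ℕ, ∀ᵐ x ∂μ, limsup (fun n : ℕ => f n x / n) atTop ≤ Fl f x + 3 * ((i+1 : ℕ):ℝ≥0∞)⁻¹ := by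
    intro i
    set ε : ℝ≥0∞ := ((i+1 : ℕ):ℝ≥0∞)⁻¹ with hε
    have hε0 : ε ≠ 0 := by simp [hε]
    have hεt : ε ≠ ∞ := by rw [hε, ENNReal.inv_ne_top]; simp
    let B : ℕ → Set Ω := fun N => {x | (∀ l ∈ Finset.Icc 1 N, (l:ℝ≥0∞) * (Fl f x + ε) < f l x)} ∪ {x | (N:ℝ≥0∞) < f 1 x}
    have hBm : ∀ N, MeasurableSet (B N) := by
      intro N
      apply MeasurableSet.union _ (measurableSet_lt measurable_const (hf 1))
      have : {x | ∀ l ∈ Finset.Icc 1 N, (l:ℝ≥0∞) * (Fl f x + ε) < f l x} =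
          ⋂ l ∈ Finset.Icc 1 N, {x | (l:ℝ≥0∞) * (Fl f x + ε) < f l x} := by
        ext x; simp
      rw [this]
      refine Finset.measurableSet_biInter _ fun l _ => ?_
      exact measurableSet_lt (((Fl_meas hf).add_const _).const_mul _) (hf l)
    have hv := vanish hT (g := fun N x => if x ∈ B N then f 1 x else 0)
      (fun K => Measurable.ite (hBm K) (hf 1) measurable_const)
      (h := f 1) (fun K x => by split_ifs <;> simp) hint ?_ ε hεt hε0
    · filter_upwards [hv, hsubo, hFo, hFfin] with x ⟨N, hN⟩ hs hFx hFf
      have hFk : ∀ k, Fl f (T^[k] x) = Fl f x := by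
        intro k
        induction k with
        | zero => rfl
        | succ k ih => rw [Function.iterate_succ_apply', hFx k, ih]
      have := greedy_king (fun k n => f n (T^[k] x)) (fun k => if T^[k] x ∈ B N then f 1 (T^[k] x) else 0)
        (Fl f x + ε) N (fun k => h0 _) ?_ ?_ ?_
      · have hlim : ∀ᶠ n : ℕ in atTop, ((N:ℝ≥0∞) * N) / n < ε := by
          have : Tendsto (fun n : ℕ => ((N:ℝ≥0∞) * N) / (n:ℝ≥0∞)) atTop (𝓝 0) := by
            have := ENNReal.Tendsto.const_div (a := (N:ℝ≥0∞) * N) ENNReal.tendsto_nat_nhds_top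
              (Or.inr (ENNReal.mul_ne_top (by simp) (by simp)))
            simpa using this
          exact this.eventually (gt_mem_nhds (pos_iff_ne_zero.2 hε0))
        apply limsup_le_of_le (by isBoundedDefault)
        filter_upwards [hlim, eventually_ge_atTop 1] with n hn hn1
        have h1 := this n 0
        simp only [Function.iterate_zero, id, zero_add] at h1
        have hn0 : (n:ℝ≥0∞) ≠ 0 := by simp; omega
        have h2 := hN n hn1
        calc f n x / n ≤ ((n:ℝ≥0∞) * (Fl f x + ε) + ε * n + (N:ℝ≥0∞) * N) / n := by
              gcongr; refine h1.trans ?_; gcongr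
          _ = (Fl f x + ε) + ε + (N:ℝ≥0∞) * N / n := by
              rw [ENNReal.add_div, ENNReal.add_div, mul_comm, ENNReal.mul_div_cancel_right hn0 (by simp),
                ENNReal.mul_div_cancel_right hn0 (by simp)]
          _ ≤ (Fl f x + ε) + ε + ε := by gcongr
          _ = _ := by ring
      · intro k m n
        have := hs k m n
        rwa [← Function.iterate_add_apply, add_comm m k] at this
      · intro k
        split_ifs with h
        · exact le_add_self
        · have : ¬ ((N:ℝ≥0∞) < f 1 (T^[k] x)) := fun h' => h (Or.inr h')
          simpa using this
      · intro k
        by_cases h : T^[k] x ∈ B N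
        · left; simp [h]
        · right
          have : ¬ (∀ l ∈ Finset.Icc 1 N, (l:ℝ≥0∞) * (Fl f (T^[k] x) + ε) < f l (T^[k] x)) := fun h' => h (Or.inl h')
          push Not at this
          obtain ⟨l, hl, hl2⟩ := this
          rw [Finset.mem_Icc] at hl
          rw [hFk] at hl2
          exact ⟨l, hl.1, hl.2, hl2⟩
    · filter_upwards [hfin, hFfin] with x hx hFx
      obtain ⟨K0, hK0⟩ := ENNReal.exists_nat_gt hx
      have hlt : Fl f x < Fl f x + ε := ENNReal.lt_add_right hFx hε0
      have hfr : ∃ᶠ n : ℕ in atTop, f n x / n < Fl f x + ε :=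
        frequently_lt_of_liminf_lt (by isBoundedDefault) hlt
      obtain ⟨l, hl, hl1⟩ := (hfr.and_eventually (eventually_ge_atTop 1)).exists
      apply tendsto_const_nhds.congr'
      filter_upwards [eventually_ge_atTop K0, eventually_ge_atTop l] with K hK hKl
      rw [if_neg]
      rintro (h | h)
      · have := h l (Finset.mem_Icc.2 ⟨hl1, hKl⟩)
        have h3 : f l x ≤ (l:ℝ≥0∞) * (Fl f x + ε) := by
          rw [mul_comm]
          refine (ENNReal.div_le_iff ?_ (by simp)).1 hl.le
          simp; omega
        exact absurd this (not_lt.2 h3)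
      · exact absurd h (not_lt.2 (hK0.le.trans (by exact_mod_cast hK)))
  rw [← ae_all_iff] at main
  filter_upwards [main, hFfin] with x hx hFx
  refine ⟨hFx, ?_⟩
  have hl : Tendsto (fun i : ℕ => Fl f x + 3 * ((i+1 : ℕ):ℝ≥0∞)⁻¹) atTop (𝓝 (Fl f x + 3 * 0)) := by
    refine Tendsto.add tendsto_const_nhds (ENNReal.Tendsto.const_mul ?_ (Or.inr (by simp)))
    exact (tendsto_add_atTop_iff_nat 1).2 ENNReal.tendsto_inv_nat_nhds_zero
  have := ge_of_tendsto' hl hx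
  simpa using this

end king

end RWRPerg

open MeasureTheory Filter Set
open scoped ENNReal NNReal Classical Topology
noncomputable section
set_option linter.unusedSectionVars false
namespace RWRP
variable {d : ℕ} {Ω : Type*}

lemma pos_cons {f g : ℕ → Zd d} {x z : Zd d} (h0 : f 0 = z) (hs : ∀ i, f (i+1) = g i) (k : ℕ) :
    pos x f (k+1) = pos (x+z) g k := by
  unfold pos
  rw [Finset.sum_range_succ', h0]
  simp only [hs]
  abel

lemma stepF_cons_zero {R : Finset (Zd d)} {n : ℕ} (z : {z : Zd d // z ∈ R}) (s : Fin n → {z : Zd d // z ∈ R}) :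
    stepF (n+1) (Fin.cons z s : Fin (n+1) → {z : Zd d // z ∈ R}) 0 = z := by
  simp [stepF]

lemma stepF_cons_succ {R : Finset (Zd d)} {n : ℕ} (z : {z : Zd d // z ∈ R}) (s : Fin n → {z : Zd d // z ∈ R}) (i : ℕ) :
    stepF (n+1) (Fin.cons z s : Fin (n+1) → {z : Zd d // z ∈ R}) (i+1) = stepF n s i := by
  unfold stepF
  by_cases h : i < n
  · have h' : i + 1 < n + 1 := by omega
    rw [dif_pos h, dif_pos h']
    have : (⟨i+1, h'⟩ : Fin (n+1)) = Fin.succ ⟨i, h⟩ := rfl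
    rw [this, Fin.cons_succ]
  · have h' : ¬ (i + 1 < n + 1) := by omega
    rw [dif_neg h, dif_neg h']

lemma firstHit_cons {f g : ℕ → Zd d} {x y z : Zd d} (h0 : f 0 = z) (hs : ∀ i, f (i+1) = g i) (n : ℕ) :
    firstHit x y (n+1+1) f ↔ x + z ≠ y ∧ firstHit (x+z) y (n+1) g := by
  unfold firstHit
  rw [pos_cons h0 hs]
  constructor
  · rintro ⟨h1, h2⟩
    refine ⟨?_, h1, ?_⟩
    · have := h2 1 (by simp)
      rwa [show (1:ℕ) = 0 + 1 from rfl, pos_cons h0 hs, pos, Finset.range_zero, Finset.sum_empty, add_zero] at this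
    · intro k hk
      have := h2 (k+1) (by simp at *; omega)
      rwa [pos_cons h0 hs] at this
  · rintro ⟨h1, h2, h3⟩
    refine ⟨h2, fun k hk => ?_⟩
    obtain ⟨j, rfl⟩ : ∃ j, k = j + 1 := ⟨k-1, by simp at hk; omega⟩
    rw [pos_cons h0 hs]
    cases j with
    | zero => simpa [pos] using h1
    | succ j => exact h3 _ (by simp at *; omega)

lemma firstHit_one {f : ℕ → Zd d} {x y z : Zd d} (h0 : f 0 = z) :
    firstHit x y 1 f ↔ x + z = y := by
  unfold firstHit pos
  simp [h0]
  intros; omega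

lemma pathV_cons (T : Zd d → Ω → Ω) (V : Ω → Zd d → ℝ) (ω : Ω) {f g : ℕ → Zd d} {x z : Zd d}
    (h0 : f 0 = z) (hs : ∀ i, f (i+1) = g i) (n : ℕ) :
    pathV T V ω x (n+1) f = V (T x ω) z + pathV T V ω (x+z) n g := by
  unfold pathV
  rw [Finset.sum_range_succ', h0]
  simp only [pos_cons h0 hs, hs]
  rw [add_comm]; congr 1
  simp [pos]

section
variable (T : Zd d → Ω → Ω) (V : Ω → Zd d → ℝ) (p : Zd d → ℝ) (R : Finset (Zd d)) (ω : Ω)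

def kap (x z : Zd d) : ℝ≥0∞ := ENNReal.ofReal (p z) * ENNReal.ofReal (Real.exp (-(V (T x ω) z)))

def hitF (n : ℕ) (x y : Zd d) : ℝ≥0∞ :=
  ∑ s : Fin (n+1) → {z : Zd d // z ∈ R},
    if firstHit x y (n+1) (stepF (n+1) s) then
      pathW p s * ENNReal.ofReal (Real.exp (-(pathV T V ω x (n+1) (stepF (n+1) s))))
    else 0

lemma walkK_eq (x y : Zd d) : walkK T V p R ω x y = ∑' n, hitF T V p R ω n x y := rfl

lemma sum_cons {n : ℕ} (F : (Fin (n+1) → {z : Zd d // z ∈ R}) → ℝ≥0∞) :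
    ∑ s, F s = ∑ z : {z : Zd d // z ∈ R}, ∑ s : Fin n → {z : Zd d // z ∈ R}, F (Fin.cons z s) := by
  rw [← Fintype.sum_prod_type']
  exact (Equiv.sum_comp (Fin.consEquiv (fun _ => {z : Zd d // z ∈ R})) F).symm

lemma hitF_zero (x y : Zd d) : hitF T V p R ω 0 x y =
    ∑ z ∈ R, kap T V p ω x z * (if x + z = y then 1 else 0) := by
  unfold hitF
  rw [sum_cons, ← Finset.sum_coe_sort R]
  apply Finset.sum_congr rfl
  intro z _
  rw [Fintype.sum_unique]
  simp only [zero_add, firstHit_one (stepF_cons_zero (n := 0) z _)]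
  split_ifs
  · simp only [mul_one, kap, pathW, pathV]
    simp [pos, stepF]
  · simp

lemma hitF_succ (n : ℕ) (x y : Zd d) : hitF T V p R ω (n+1) x y =
    ∑ z ∈ R, kap T V p ω x z * (if x + z = y then 0 else hitF T V p R ω n (x+z) y) := by
  conv_lhs => unfold hitF
  rw [sum_cons, ← Finset.sum_coe_sort R]
  apply Finset.sum_congr rfl
  intro z _
  simp only [firstHit_cons (stepF_cons_zero z _) (stepF_cons_succ z _),
    pathV_cons T V ω (stepF_cons_zero z _) (stepF_cons_succ z _)]
  by_cases h : x + z = y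
  · simp [h]
  · simp only [h, ne_eq, not_false_eq_true, true_and, if_false]
    unfold hitF
    rw [Finset.mul_sum]
    apply Finset.sum_congr rfl
    intro s _
    split_ifs
    · rw [neg_add, Real.exp_add, ENNReal.ofReal_mul (Real.exp_nonneg _)]
      unfold kap pathW
      rw [Fin.prod_univ_succ]
      simp only [Fin.cons_zero, Fin.cons_succ]
      ring
    · simp

def ww (x y : Zd d) : ℝ≥0∞ := if y = x then 1 else walkK T V p R ω x y

lemma walkK_step (x y : Zd d) : walkK T V p R ω x y =
    ∑ z ∈ R, kap T V p ω x z * ww T V p R ω (x+z) y := by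
  rw [walkK_eq, tsum_eq_zero_add' ENNReal.summable, hitF_zero]
  simp only [hitF_succ]
  rw [Summable.tsum_finsetSum (fun _ _ => ENNReal.summable), ← Finset.sum_add_distrib]
  apply Finset.sum_congr rfl
  intro z _
  rw [ENNReal.tsum_mul_left, ← mul_add]
  congr 1
  unfold ww
  by_cases h : x + z = y
  · simp [h]
  · simp [h, Ne.symm h, walkK_eq]

lemma walkK_le (y : Zd d) (h : Zd d → ℝ≥0∞) (hsup : ∀ x, ∑ z ∈ R, kap T V p ω x z * h (x+z) ≤ h x)
    (x : Zd d) : walkK T V p R ω x y * h y ≤ h x := by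
  have key : ∀ n x, (∑ m ∈ Finset.range n, hitF T V p R ω m x y) * h y ≤ h x := by
    intro n
    induction n with
    | zero => intro x; simp
    | succ n ih =>
      intro x
      rw [Finset.sum_range_succ', hitF_zero]
      simp only [hitF_succ]
      rw [Finset.sum_comm, ← Finset.sum_add_distrib, Finset.sum_mul]
      refine le_trans (Finset.sum_le_sum fun z hz => ?_) (hsup x)
      rw [← Finset.mul_sum, ← mul_add, mul_assoc]
      gcongr
      by_cases hxy : x + z = y
      · simp [hxy]
      · simp only [hxy, if_false, add_zero]
        exact ih _
  rw [walkK_eq, ENNReal.tsum_eq_iSup_nat, ENNReal.iSup_mul]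
  exact iSup_le fun n => key n x

end

section good
variable {T : Zd d → Ω → Ω} {V : Ω → Zd d → ℝ} {p : Zd d → ℝ} {R : Finset (Zd d)} {ω : Ω}
variable {ℓ : (Fin d → ℝ) →ₗ[ℝ] ℝ}

def GoodV (T : Zd d → Ω → Ω) (V : Ω → Zd d → ℝ) (R : Finset (Zd d)) (ℓ : (Fin d → ℝ) →ₗ[ℝ] ℝ) (ω : Ω) : Prop :=
  ∀ x : Zd d, ∀ z ∈ R, 0 ≤ V (T x ω) z + ℓ (toR z)

lemma toR_add (x y : Zd d) : toR (x + y) = toR x + toR y := by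
  ext i; simp [toR]
lemma toR_sub (x y : Zd d) : toR (x - y) = toR x - toR y := by
  ext i; simp [toR]
@[simp] lemma toR_zero : toR (0 : Zd d) = 0 := by
  ext i; simp [toR]

lemma exp_super (hg : GoodV T V R ℓ ω) (hp : ∀ z ∈ R, 0 < p z) (hp1 : ∑ z ∈ R, p z = 1)
    (y x : Zd d) : ∑ z ∈ R, kap T V p ω x z * ENNReal.ofReal (Real.exp (ℓ (toR (y - (x+z))))) ≤
      ENNReal.ofReal (Real.exp (ℓ (toR (y - x)))) := by
  calc _ ≤ ∑ z ∈ R, ENNReal.ofReal (p z) * ENNReal.ofReal (Real.exp (ℓ (toR (y - x)))) := by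
        apply Finset.sum_le_sum
        intro z hz
        unfold kap
        rw [mul_assoc, ← ENNReal.ofReal_mul (Real.exp_nonneg _), ← Real.exp_add]
        gcongr
        have := hg x z hz
        rw [show y - (x+z) = (y - x) - z by abel, toR_sub _ z, map_sub]
        linarith
    _ = _ := by
        rw [← Finset.sum_mul, ← ENNReal.ofReal_sum_of_nonneg (fun z hz => (hp z hz).le), hp1]
        simp

lemma walkK_bound (hg : GoodV T V R ℓ ω) (hp : ∀ z ∈ R, 0 < p z) (hp1 : ∑ z ∈ R, p z = 1)
    (x y : Zd d) : walkK T V p R ω x y ≤ ENNReal.ofReal (Real.exp (ℓ (toR (y - x)))) := by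
  have := walkK_le T V p R ω y _ (exp_super hg hp hp1 y) x
  simpa using this

lemma ww_bound (hg : GoodV T V R ℓ ω) (hp : ∀ z ∈ R, 0 < p z) (hp1 : ∑ z ∈ R, p z = 1)
    (x y : Zd d) : ww T V p R ω x y ≤ ENNReal.ofReal (Real.exp (ℓ (toR (y - x)))) := by
  unfold ww
  split_ifs with h
  · simp [h]
  · exact walkK_bound hg hp hp1 x y

lemma ww_super (hg : GoodV T V R ℓ ω) (hp : ∀ z ∈ R, 0 < p z) (hp1 : ∑ z ∈ R, p z = 1)
    (y x : Zd d) : ∑ z ∈ R, kap T V p ω x z * ww T V p R ω (x+z) y ≤ ww T V p R ω x y := by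
  rw [← walkK_step]
  unfold ww
  split_ifs with h
  · have := walkK_bound hg hp hp1 x y
    simpa [h] using this
  · exact le_rfl

lemma ww_mul (hg : GoodV T V R ℓ ω) (hp : ∀ z ∈ R, 0 < p z) (hp1 : ∑ z ∈ R, p z = 1)
    (x y z : Zd d) : ww T V p R ω x y * ww T V p R ω y z ≤ ww T V p R ω x z := by
  by_cases h : y = x
  · subst h
    simp [ww]
  · have := walkK_le T V p R ω y _ (ww_super hg hp hp1 z) x
    simpa only [ww, h, if_false] using this

lemma ww_step (hg : GoodV T V R ℓ ω) (hp : ∀ z ∈ R, 0 < p z) (hp1 : ∑ z ∈ R, p z = 1)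
    (x z : Zd d) (hz : z ∈ R) : kap T V p ω x z ≤ ww T V p R ω x (x+z) := by
  refine le_trans ?_ (ww_super hg hp hp1 (x+z) x)
  refine le_trans ?_ (Finset.single_le_sum (f := fun z' => kap T V p ω x z' * ww T V p R ω (x+z') (x+z))
    (fun _ _ => zero_le) hz)
  simp [ww]

lemma ww_ne_top (hg : GoodV T V R ℓ ω) (hp : ∀ z ∈ R, 0 < p z) (hp1 : ∑ z ∈ R, p z = 1)
    (x y : Zd d) : ww T V p R ω x y ≠ ∞ :=
  ne_top_of_le_ne_top ENNReal.ofReal_ne_top (ww_bound hg hp hp1 x y)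

lemma kap_pos (hp : ∀ z ∈ R, 0 < p z) (x z : Zd d) (hz : z ∈ R) : 0 < kap T V p ω x z := by
  unfold kap
  have := hp z hz
  have h2 := Real.exp_pos (-(V (T x ω) z))
  apply ENNReal.mul_pos <;> simp [this, h2]

lemma ww_pos (hg : GoodV T V R ℓ ω) (hp : ∀ z ∈ R, 0 < p z) (hp1 : ∑ z ∈ R, p z = 1)
    (x y : Zd d) (hy : y ∈ AddSubmonoid.closure (R : Set (Zd d))) : 0 < ww T V p R ω x (x+y) := by
  induction hy using AddSubmonoid.closure_induction generalizing x with
  | mem z hz => exact (kap_pos hp x z hz).trans_le (ww_step hg hp hp1 x z hz)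
  | zero => simp [ww]
  | add y z _ _ h1 h2 =>
    refine lt_of_lt_of_le ?_ (ww_mul hg hp hp1 x (x+y) (x+(y+z)))
    rw [← add_assoc]
    exact ENNReal.mul_pos (h1 x).ne' (h2 _).ne'

lemma aFun_eq (x y : Zd d) : aFun T V p R ω x y = - Real.log (ww T V p R ω x y).toReal := by
  unfold aFun ww
  split_ifs <;> simp

/-- gauge-transformed -/
def bb (T : Zd d → Ω → Ω) (V : Ω → Zd d → ℝ) (p : Zd d → ℝ) (R : Finset (Zd d))
   (ℓ : (Fin d → ℝ) →ₗ[ℝ] ℝ) (ω : Ω) (x y : Zd d) : ℝ := aFun T V p R ω x y + ℓ (toR (y - x))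

lemma bb_self (x : Zd d) : bb T V p R ℓ ω x x = 0 := by simp [bb, aFun]

lemma bb_nonneg (hg : GoodV T V R ℓ ω) (hp : ∀ z ∈ R, 0 < p z) (hp1 : ∑ z ∈ R, p z = 1)
    (x y : Zd d) (hy : y ∈ AddSubmonoid.closure (R : Set (Zd d))) : 0 ≤ bb T V p R ℓ ω x (x+y) := by
  unfold bb
  rw [aFun_eq]
  have h1 := ww_bound hg hp hp1 x (x+y)
  have h2 := ww_pos hg hp hp1 x y hy
  have h3 : (ww T V p R ω x (x+y)).toReal ≤ Real.exp (ℓ (toR (x+y-x))) :=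
    ENNReal.toReal_le_of_le_ofReal (Real.exp_nonneg _) h1
  have h4 : 0 < (ww T V p R ω x (x+y)).toReal := ENNReal.toReal_pos h2.ne' (ww_ne_top hg hp hp1 _ _)
  have := Real.log_le_log h4 h3
  rw [Real.log_exp] at this
  linarith

lemma bb_sub (hg : GoodV T V R ℓ ω) (hp : ∀ z ∈ R, 0 < p z) (hp1 : ∑ z ∈ R, p z = 1)
    (x y z : Zd d) (hy : y ∈ AddSubmonoid.closure (R : Set (Zd d)))
    (hz : z ∈ AddSubmonoid.closure (R : Set (Zd d))) :
    bb T V p R ℓ ω x (x+(y+z)) ≤ bb T V p R ℓ ω x (x+y) + bb T V p R ℓ ω (x+y) (x+(y+z)) := by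
  unfold bb
  simp only [aFun_eq]
  have h2 := ww_mul hg hp hp1 x (x+y) (x+(y+z))
  have h3 := ENNReal.toReal_mono (ww_ne_top hg hp hp1 _ _) h2
  rw [ENNReal.toReal_mul] at h3
  have h4 : 0 < (ww T V p R ω x (x+y)).toReal :=
    ENNReal.toReal_pos (ww_pos hg hp hp1 x y hy).ne' (ww_ne_top hg hp hp1 _ _)
  have h5 : 0 < (ww T V p R ω (x+y) (x+(y+z))).toReal := by
    rw [← add_assoc]
    exact ENNReal.toReal_pos (ww_pos hg hp hp1 (x+y) z hz).ne' (ww_ne_top hg hp hp1 _ _)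
  have := Real.log_le_log (mul_pos h4 h5) h3
  rw [Real.log_mul h4.ne' h5.ne'] at this
  have e1 : x + (y+z) - x = y + z := by abel
  have e2 : x + y - x = y := by abel
  have e3 : x + (y+z) - (x+y) = z := by abel
  rw [e1, e2, e3, toR_add, map_add]
  linarith

lemma bb_step (hg : GoodV T V R ℓ ω) (hp : ∀ z ∈ R, 0 < p z) (hp1 : ∑ z ∈ R, p z = 1)
    (x z : Zd d) (hz : z ∈ R) :
    bb T V p R ℓ ω x (x+z) ≤ max (V (T x ω) z) 0 + (|ℓ (toR z)| + |Real.log (p z)|) := by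
  unfold bb
  rw [aFun_eq]
  have h3 := ENNReal.toReal_mono (ww_ne_top hg hp hp1 _ _) (ww_step hg hp hp1 x z hz)
  have h4 : 0 < p z * Real.exp (-(V (T x ω) z)) := mul_pos (hp z hz) (Real.exp_pos _)
  have h5 : (kap T V p ω x z).toReal = p z * Real.exp (-(V (T x ω) z)) := by
    unfold kap
    rw [ENNReal.toReal_mul, ENNReal.toReal_ofReal (hp z hz).le, ENNReal.toReal_ofReal (Real.exp_nonneg _)]
  rw [h5] at h3
  have := Real.log_le_log h4 h3
  rw [Real.log_mul (hp z hz).ne' (Real.exp_ne_zero _), Real.log_exp] at this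
  rw [show x + z - x = z by abel]
  have h6 := le_max_left (V (T x ω) z) 0
  have h7 := le_abs_self (ℓ (toR z))
  have h8 := neg_abs_le (Real.log (p z))
  linarith

lemma bb_shift (hT : ∀ x y : Zd d, T (x + y) = T x ∘ T y) (w x y : Zd d) :
    bb T V p R ℓ ω (w + x) (w + y) = bb T V p R ℓ (T w ω) x y := by
  have hk : walkK T V p R ω (w+x) (w+y) = walkK T V p R (T w ω) x y := by
    have hpos : ∀ f k, pos (w+x) f k = w + pos x f k := fun f k => by simp [pos, add_assoc]
    unfold walkK
    refine tsum_congr fun n => Finset.sum_congr rfl fun s _ => ?_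
    have h1 : firstHit (w+x) (w+y) (n+1) (stepF (n+1) s) ↔ firstHit x y (n+1) (stepF (n+1) s) := by
      unfold firstHit; simp [hpos]
    have h2 : pathV T V ω (w+x) (n+1) (stepF (n+1) s) = pathV T V (T w ω) x (n+1) (stepF (n+1) s) := by
      unfold pathV
      refine Finset.sum_congr rfl fun i _ => ?_
      rw [hpos, add_comm, hT]; rfl
    rw [h2]; simp only [h1]
  unfold bb aFun
  rw [hk]
  simp

lemma aFun_meas [MeasurableSpace Ω] (hT : ∀ z : Zd d, Measurable (T z)) (hV : ∀ z : Zd d, Measurable fun ω => V ω z)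
    (x y : Zd d) : Measurable fun ω => aFun T V p R ω x y := by
  have : Measurable fun ω => walkK T V p R ω x y := by
    unfold walkK
    refine Measurable.tsum fun n => Finset.measurable_sum _ fun s _ => ?_
    split_ifs
    · refine Measurable.const_mul ?_ _
      refine ENNReal.measurable_ofReal.comp (Real.measurable_exp.comp (Measurable.neg ?_))
      unfold pathV
      exact Finset.measurable_sum _ fun i _ => (hV _).comp (hT _)
    · exact measurable_const
  unfold aFun
  split_ifs
  · exact measurable_const
  · exact (Real.measurable_log.comp this.ennreal_toReal).neg

end good
end RWRP

open MeasureTheory Filter Set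
open scoped ENNReal NNReal Classical Topology
noncomputable section
set_option linter.unusedSectionVars false
namespace RWRP
variable {d : ℕ}

lemma relint_line {A : Set (Fin d → ℝ)} (h0 : (0 : Fin d → ℝ) ∈ A) {ξ v : Fin d → ℝ}
    (hξ : ξ ∈ intrinsicInterior ℝ A) (hv : v ∈ Submodule.span ℝ A) :
    ∃ ε : ℝ, 0 < ε ∧ ξ + ε • v ∈ A := by
  rw [mem_intrinsicInterior] at hξ
  obtain ⟨y, hy, rfl⟩ := hξ
  have hspan : ∀ w, w ∈ Submodule.span ℝ A → w ∈ affineSpan ℝ A := by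
    intro w hw
    have hd : (affineSpan ℝ A).direction = Submodule.span ℝ A := by
      rw [direction_affineSpan, vectorSpan_eq_span_vsub_set_right ℝ h0]
      congr 1; ext x; simp
    have h0' : (0 : Fin d → ℝ) ∈ affineSpan ℝ A := subset_affineSpan ℝ A h0
    rw [← AffineSubspace.vsub_right_mem_direction_iff_mem h0', hd]
    simpa using hw
  have hyS : (y : Fin d → ℝ) ∈ Submodule.span ℝ A := by
    have hd : (affineSpan ℝ A).direction = Submodule.span ℝ A := by
      rw [direction_affineSpan, vectorSpan_eq_span_vsub_set_right ℝ h0]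
      congr 1; ext x; simp
    have h0' : (0 : Fin d → ℝ) ∈ affineSpan ℝ A := subset_affineSpan ℝ A h0
    have := y.2
    rw [← AffineSubspace.vsub_right_mem_direction_iff_mem h0', hd] at this
    simpa using this
  let c : ℝ → affineSpan ℝ A := fun ε => ⟨(y : Fin d → ℝ) + ε • v,
    hspan _ (Submodule.add_mem _ hyS (Submodule.smul_mem _ _ hv))⟩
  have hc : Continuous c := by
    apply Continuous.subtype_mk
    fun_prop
  have hc0 : c 0 = y := by ext; simp [c]
  have hmem : ∀ᶠ ε in 𝓝 (0:ℝ), c ε ∈ interior ((↑) ⁻¹' A : Set (affineSpan ℝ A)) :=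
    hc.continuousAt.eventually (isOpen_interior.mem_nhds (by rw [hc0]; exact hy))
  obtain ⟨δ, hδ, h⟩ := Metric.eventually_nhds_iff.1 hmem
  refine ⟨δ/2, by linarith, ?_⟩
  have := interior_subset (h (y := δ/2) (by simp [abs_of_pos hδ]; linarith))
  exact this

lemma exists_functional (R : Finset (Zd d)) (U₀ : Set (Fin d → ℝ)) (hU₀ : IsZeroFace R U₀) (c : ℝ) :
    ∃ ℓ : (Fin d → ℝ) →ₗ[ℝ] ℝ, (∀ z ∈ R, toR z ∈ U₀ → ℓ (toR z) = 0) ∧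
      ∀ z ∈ R, toR z ∉ U₀ → c ≤ ℓ (toR z) := by
  set B : Set (Fin d → ℝ) := toR '' {z | z ∈ R ∧ toR z ∈ U₀} with hB
  set W := Submodule.span ℝ B with hW
  set K := convexHull ℝ (toR '' {z | z ∈ R ∧ toR z ∉ U₀}) with hK
  have hKU : K ⊆ hullU R := convexHull_mono (image_mono fun z hz => hz.1)
  have hdisj : Disjoint K (W : Set (Fin d → ℝ)) := by
    rw [Set.disjoint_left]
    intro v hvK hvW
    rcases hU₀ with ⟨h0U, hface, h0int⟩ | ⟨h0U, hemp⟩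
    · have h0A : (0 : Fin d → ℝ) ∈ U₀ := intrinsicInterior_subset h0int
      have hBU : B ⊆ U₀ := by rintro _ ⟨z, hz, rfl⟩; exact hz.2
      have hvs : -v ∈ Submodule.span ℝ U₀ := Submodule.neg_mem _ (Submodule.span_mono hBU hvW)
      obtain ⟨ε, hε, hmem⟩ := relint_line h0A h0int hvs
      have hvU : v ∈ U₀ := by
        have hpos : 0 < 1 + ε := by linarith
        refine (hface.2.2 (ξ := 0) (ζ := v) (η := 0 + ε • -v) (t := ε / (1+ε)) h0A (hKU hvK)
          (hface.1 hmem) ⟨by positivity, by rw [div_lt_one hpos]; linarith⟩ ?_).1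
        have : (1 - ε/(1+ε)) = 1/(1+ε) := by field_simp; ring
        rw [this, zero_add, smul_neg, smul_neg, smul_smul]
        rw [show 1 / (1+ε) * ε = ε / (1+ε) by ring]; simp
      have hconv : Convex ℝ (hullU R \ U₀) := by
        rw [convex_iff_forall_pos]
        intro x hx y hy a b ha hb hab
        refine ⟨convex_convexHull ℝ _ hx.1 hy.1 ha.le hb.le hab, fun hmem => ?_⟩
        have hb' : b = 1 - a := by linarith
        exact hx.2 (hface.2.2 hmem hx.1 hy.1 ⟨ha, by linarith⟩ (by rw [hb'])).1
      have hKsub : K ⊆ hullU R \ U₀ := by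
        apply convexHull_min _ hconv
        rintro _ ⟨z, hz, rfl⟩
        exact ⟨subset_convexHull ℝ _ ⟨z, hz.1, rfl⟩, hz.2⟩
      exact (hKsub hvK).2 hvU
    · have : B = ∅ := by
        rw [hB, hemp]; simp
      rw [hW, this, Submodule.span_empty] at hvW
      have hv0 : v = 0 := by simpa using hvW
      rw [hv0] at hvK
      exact h0U (hKU hvK)
  have hfin : (toR '' {z | z ∈ R ∧ toR z ∉ U₀}).Finite :=
    ((R.finite_toSet).subset fun z hz => hz.1).image _
  obtain ⟨f, u, v, h1, huv, h2⟩ := geometric_hahn_banach_compact_closed (convex_convexHull ℝ _)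
    (hfin.isCompact_convexHull ℝ) W.convex (Submodule.closed_of_finiteDimensional W) hdisj
  have hv0 : v < 0 := by simpa using h2 0 W.zero_mem
  have hfW : ∀ w ∈ W, f w = 0 := by
    intro w hw
    by_contra hne
    have := h2 ((v / f w) • w) (W.smul_mem _ hw)
    rw [map_smul, smul_eq_mul, div_mul_cancel₀ _ hne] at this
    exact lt_irrefl _ this
  refine ⟨(|c| / u) • (f : (Fin d → ℝ) →ₗ[ℝ] ℝ), ?_, ?_⟩
  · intro z hz hzU
    have := hfW (toR z) (Submodule.subset_span ⟨z, ⟨hz, hzU⟩, rfl⟩)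
    simp [this]
  · intro z hz hzU
    have := h1 (toR z) (subset_convexHull ℝ _ ⟨z, ⟨hz, hzU⟩, rfl⟩)
    have hu0 : u < 0 := huv.trans hv0
    simp only [LinearMap.smul_apply, ContinuousLinearMap.coe_coe, smul_eq_mul]
    have h3 : 1 ≤ f (toR z) / u := by rw [le_div_iff_of_neg hu0]; linarith
    calc c ≤ |c| * 1 := by rw [mul_one]; exact le_abs_self c
      _ ≤ |c| * (f (toR z) / u) := by gcongr
      _ = _ := by ring

/-- support lemma for faces of the cone -/
lemma face_supp {R : Finset (Zd d)} {A : Set (Fin d → ℝ)} (hA : IsFace (Cp R) A)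
    (b : Zd d → ℝ) (hb : ∀ z, 0 ≤ b z) (hmem : ∑ z ∈ R, b z • toR z ∈ A) (z : Zd d) (hz : z ∈ R)
    (hbz : 0 < b z) : toR z ∈ A := by
  set t := min (b z) (1/2) with ht
  have ht0 : 0 < t := lt_min hbz (by norm_num)
  have ht1 : t < 1 := (min_le_right _ _).trans_lt (by norm_num)
  have htb : t ≤ b z := min_le_left _ _
  have ht1' : 0 < 1 - t := by linarith
  refine (hA.2.2 (ζ := toR z) (η := ∑ w ∈ R, ((1-t)⁻¹ * (b w - if w = z then t else 0)) • toR w) (t := t)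
    hmem ?_ ?_ ⟨ht0, ht1⟩ ?_).1
  · refine ⟨fun w => if w = z then 1 else 0, fun w => by beta_reduce; split_ifs <;> norm_num, ?_⟩
    simp [hz]
  · refine ⟨_, fun w => ?_, rfl⟩
    apply mul_nonneg (by positivity)
    split_ifs with h
    · rw [h]; linarith
    · simpa using hb w
  · rw [Finset.smul_sum]
    simp only [smul_smul, mul_inv_cancel_left₀ ht1'.ne', sub_smul, Finset.sum_sub_distrib, ite_smul, zero_smul]
    simp [hz]

/-- strictly positive cone combos -/
def Pp (S : Finset (Zd d)) : Set (Fin d → ℝ) :=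
  {ξ | ∃ γ : Zd d → ℝ, (∀ z ∈ S, 0 < γ z) ∧ ξ = ∑ z ∈ S, γ z • toR z}

lemma face_zero {R : Finset (Zd d)} {A : Set (Fin d → ℝ)} (hA : IsFace (Cp R) A)
    (hne : A.Nonempty) : (0 : Fin d → ℝ) ∈ A := by
  obtain ⟨ξ, hξ⟩ := hne
  obtain ⟨b, hb, hbe⟩ := hA.1 hξ
  refine (hA.2.2 (ζ := 0) (η := (2:ℝ) • ξ) (t := 1/2) hξ ⟨fun _ => 0, by simp, by simp⟩ ?_ ⟨by norm_num, by norm_num⟩ ?_).1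
  · refine ⟨fun z => 2 * b z, fun z => by have := hb z; positivity, ?_⟩
    rw [hbe, Finset.smul_sum]
    simp only [smul_smul]
  · rw [smul_zero, zero_add, smul_smul]; norm_num

lemma relint_sub_Pp {R : Finset (Zd d)} {A : Set (Fin d → ℝ)} (hA : IsFace (Cp R) A)
    (hne : A.Nonempty) {S : Finset (Zd d)} (hS : ∀ z, z ∈ S ↔ z ∈ R ∧ toR z ∈ A) :
    intrinsicInterior ℝ A ⊆ Pp S := by
  intro ξ hξ
  have hv : -∑ z ∈ S, toR z ∈ Submodule.span ℝ A :=
    Submodule.neg_mem _ (Submodule.sum_mem _ fun z hz => Submodule.subset_span ((hS z).1 hz).2)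
  obtain ⟨ε, hε, hmem⟩ := relint_line (face_zero hA hne) hξ hv
  obtain ⟨b, hb, hbe⟩ := hA.1 hmem
  have hsupp := face_supp hA b hb (hbe ▸ hmem)
  have hSR : S ⊆ R := fun z hz => ((hS z).1 hz).1
  have h2 : ∑ z ∈ R, b z • toR z = ∑ z ∈ S, b z • toR z := by
    symm
    apply Finset.sum_subset hSR
    intro z hz hzS
    have : ¬ (0 < b z) := fun h => hzS ((hS z).2 ⟨hz, hsupp z hz h⟩)
    have : b z = 0 := le_antisymm (not_lt.1 this) (hb z)
    simp [this]
  refine ⟨fun z => b z + ε, fun z _ => by have := hb z; positivity, ?_⟩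
  simp only [add_smul, Finset.sum_add_distrib]
  rw [← h2, ← hbe, ← Finset.smul_sum]
  simp

@[simp] lemma toR_sum {ι : Type*} (s : Finset ι) (f : ι → Zd d) : toR (∑ i ∈ s, f i) = ∑ i ∈ s, toR (f i) := by
  ext i; simp [toR]
@[simp] lemma toR_nsmul (n : ℕ) (x : Zd d) : toR (n • x) = (n:ℝ) • toR x := by
  ext i; simp [toR]
@[simp] lemma toR_zsmul (n : ℤ) (x : Zd d) : toR (n • x) = (n:ℝ) • toR x := by
  ext i; simp [toR]

lemma mem_Gp_iff {S : Finset (Zd d)} {x : Zd d} : x ∈ Gp S ↔ x ∈ AddSubmonoid.closure (S : Set (Zd d)) := by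
  constructor
  · rintro ⟨b, rfl⟩
    exact sum_mem fun z hz => nsmul_mem (AddSubmonoid.subset_closure hz) _
  · intro h
    obtain ⟨f, -, hf⟩ := AddSubmonoid.mem_closure_finset.1 h
    exact ⟨f, hf.symm⟩

lemma Gp_face {R : Finset (Zd d)} {A : Set (Fin d → ℝ)} (hA : IsFace (Cp R) A)
    {S : Finset (Zd d)} (hS : ∀ z, z ∈ S ↔ z ∈ R ∧ toR z ∈ A) {x : Zd d} (hx : x ∈ Gp R) (hxA : toR x ∈ A) :
    x ∈ Gp S := by
  obtain ⟨b, rfl⟩ := hx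
  refine ⟨b, ?_⟩
  have hSR : S ⊆ R := fun z hz => ((hS z).1 hz).1
  symm
  apply Finset.sum_subset hSR
  intro z hz hzS
  by_contra hne
  have hb : b z ≠ 0 := by rintro h; simp [h] at hne
  apply hzS
  refine (hS z).2 ⟨hz, face_supp hA (fun z => (b z : ℝ)) (fun _ => by positivity) ?_ z hz (by positivity)⟩
  rw [toR_sum] at hxA; simp only [toR_nsmul] at hxA; exact hxA

lemma lattice_bound (S : Finset (Zd d)) : ∃ K : ℝ, 0 ≤ K ∧ ∀ g ∈ AddSubgroup.closure (S : Set (Zd d)),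
    ∃ k : Zd d → ℤ, g = ∑ z ∈ S, k z • z ∧ ∀ z, |(k z : ℝ)| ≤ K * n1Z g := by
  set L : Submodule ℤ (Zd d) := Submodule.span ℤ (S : Set (Zd d)) with hL
  let π : (S → ℤ) →ₗ[ℤ] L :=
    { toFun := fun k => ⟨∑ z : S, k z • (z : Zd d), Submodule.sum_mem _ fun z _ =>
        Submodule.smul_mem _ _ (Submodule.subset_span z.2)⟩
      map_add' := fun a b => by ext; simp [add_smul, add_mul, Finset.sum_add_distrib]
      map_smul' := fun a b => by ext; simp [mul_assoc, Finset.mul_sum] }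
  have hπ : Function.Surjective π := by
    rintro ⟨g, hg⟩
    obtain ⟨f, -, hf⟩ := Submodule.mem_span_finset.1 hg
    refine ⟨fun z => f z, ?_⟩
    ext1
    simp only [π, LinearMap.coe_mk, AddHom.coe_mk]
    rw [← hf]
    exact Finset.sum_coe_sort S (fun z => f z • z)
  obtain ⟨σ, hσ⟩ := Module.projective_lifting_property π LinearMap.id hπ
  have hext : ∀ z : S, ∃ h : Zd d →+ ℚ, ∀ g : L, h g = ((σ g z : ℤ) : ℚ) := by
    intro z
    let f0 : L →+ ℚ := (Int.castAddHom ℚ).comp ((Pi.evalAddMonoidHom (fun _ : S => ℤ) z).comp σ.toAddMonoidHom)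
    obtain ⟨h, hh⟩ := (Module.Baer.of_divisible ℚ).extension_property_addMonoidHom L.subtype.toAddMonoidHom
      (Subtype.val_injective) f0
    refine ⟨h, fun g => ?_⟩
    exact DFunLike.congr_fun hh g
  choose h hh using hext
  refine ⟨∑ z : S, ∑ i, |((h z (Pi.single i 1) : ℚ) : ℝ)|, by positivity, ?_⟩
  intro g hg
  have hgL : g ∈ L := by
    rw [hL, ← Submodule.mem_toAddSubgroup, Submodule.span_int_eq_addSubgroupClosure]; exact hg
  refine ⟨fun z => if hz : z ∈ S then σ ⟨g, hgL⟩ ⟨z, hz⟩ else 0, ?_, ?_⟩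
  · have := DFunLike.congr_fun hσ ⟨g, hgL⟩
    have h2 := congrArg Subtype.val this
    simp only [LinearMap.comp_apply, LinearMap.id_apply, π, LinearMap.coe_mk, AddHom.coe_mk] at h2
    rw [← Finset.sum_coe_sort S]
    conv_lhs => rw [← h2]
    apply Finset.sum_congr rfl
    intro z _
    simp
  · intro z
    by_cases hz : z ∈ S
    · simp only [hz, dif_pos]
      have h1 := hh ⟨z, hz⟩ ⟨g, hgL⟩
      have h2 : h ⟨z, hz⟩ g = ∑ i, (g i : ℚ) * h ⟨z, hz⟩ (Pi.single i 1) := by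
        conv_lhs => rw [← Finset.univ_sum_single g]
        rw [map_sum]
        apply Finset.sum_congr rfl
        intro i _
        have : (Pi.single i (g i) : Zd d) = g i • Pi.single i 1 := by
          ext j; simp [Pi.single_apply]
        rw [this, map_zsmul]; simp
      have h3 : ((σ ⟨g, hgL⟩ ⟨z, hz⟩ : ℤ) : ℝ) = ∑ i, (g i : ℝ) * (h ⟨z, hz⟩ (Pi.single i 1) : ℝ) := by
        have : ((σ ⟨g, hgL⟩ ⟨z, hz⟩ : ℤ) : ℚ) = ∑ i, (g i : ℚ) * h ⟨z, hz⟩ (Pi.single i 1) := by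
          rw [← h1, ← h2]
        exact_mod_cast congrArg (fun q : ℚ => (q : ℝ)) this
      rw [h3]
      set C := ∑ z : S, ∑ i, |((h z (Pi.single i 1) : ℚ) : ℝ)| with hC
      have h4 : ∀ i, |((h ⟨z, hz⟩ (Pi.single i 1) : ℚ) : ℝ)| ≤ C := by
        intro i
        calc _ ≤ ∑ i, |((h ⟨z, hz⟩ (Pi.single i 1) : ℚ) : ℝ)| :=
              Finset.single_le_sum (f := fun i => |((h ⟨z, hz⟩ (Pi.single i 1) : ℚ) : ℝ)|) (fun _ _ => abs_nonneg _) (Finset.mem_univ i)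
          _ ≤ _ := Finset.single_le_sum (f := fun z : S => ∑ i, |((h z (Pi.single i 1) : ℚ) : ℝ)|)
              (fun _ _ => Finset.sum_nonneg fun _ _ => abs_nonneg _) (Finset.mem_univ _)
      calc |∑ i, (g i : ℝ) * (h ⟨z, hz⟩ (Pi.single i 1) : ℝ)| ≤ ∑ i, |(g i : ℝ) * (h ⟨z, hz⟩ (Pi.single i 1) : ℝ)| :=
            Finset.abs_sum_le_sum_abs _ _
        _ ≤ ∑ i, |(g i : ℝ)| * C := by
            apply Finset.sum_le_sum; intro i _; rw [abs_mul]; gcongr; exact h4 i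
        _ = C * n1Z g := by rw [← Finset.sum_mul, mul_comm]; rfl
    · simp only [hz, dif_neg, not_false_eq_true, Int.cast_zero, abs_zero]
      apply mul_nonneg
      · positivity
      · unfold n1Z n1
        exact Finset.sum_nonneg fun _ _ => abs_nonneg _

end RWRP

open MeasureTheory Filter Set
open scoped ENNReal NNReal Classical Topology
noncomputable section
set_option linter.unusedSectionVars false
namespace RWRP
variable {d : ℕ}

abbrev Gm (S : Finset (Zd d)) : AddSubmonoid (Zd d) := AddSubmonoid.closure (S : Set (Zd d))

lemma n1Z_nonneg (x : Zd d) : 0 ≤ n1Z x := by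
  unfold n1Z n1; exact Finset.sum_nonneg fun _ _ => abs_nonneg _
lemma n1_add_le (x y : Fin d → ℝ) : n1 (x + y) ≤ n1 x + n1 y := by
  unfold n1; rw [← Finset.sum_add_distrib]
  exact Finset.sum_le_sum fun i _ => abs_add_le _ _
lemma n1_smul (c : ℝ) (x : Fin d → ℝ) : n1 (c • x) = |c| * n1 x := by
  unfold n1; rw [Finset.mul_sum]
  exact Finset.sum_congr rfl fun i _ => by simp [abs_mul]
lemma n1Z_add_le (x y : Zd d) : n1Z (x + y) ≤ n1Z x + n1Z y := by
  unfold n1Z; rw [toR_add]; exact n1_add_le _ _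
lemma n1Z_nsmul (k : ℕ) (x : Zd d) : n1Z (k • x) = k * n1Z x := by
  unfold n1Z; rw [toR_nsmul, n1_smul]; simp
lemma n1_sum_le {ι : Type*} (s : Finset ι) (f : ι → Fin d → ℝ) : n1 (∑ i ∈ s, f i) ≤ ∑ i ∈ s, n1 (f i) := by
  induction s using Finset.induction_on with
  | empty => simp [n1]
  | insert a s ha ih => rw [Finset.sum_insert ha, Finset.sum_insert ha]; exact (n1_add_le _ _).trans (by linarith)
lemma n1Z_sum_le {ι : Type*} (s : Finset ι) (f : ι → Zd d) : n1Z (∑ i ∈ s, f i) ≤ ∑ i ∈ s, n1Z (f i) := by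
  unfold n1Z; rw [toR_sum]; exact n1_sum_le _ _
lemma n1_cont : Continuous (n1 : (Fin d → ℝ) → ℝ) := by
  unfold n1; fun_prop

structure DB (S : Finset (Zd d)) (b : Zd d → Zd d → ℝ) : Prop where
  nn : ∀ x y, y ∈ Gm S → 0 ≤ b x (x + y)
  sub : ∀ x y z, y ∈ Gm S → z ∈ Gm S → b x (x + (y + z)) ≤ b x (x + y) + b (x + y) (x + (y + z))
  self : ∀ x, b x x = 0
  H : ∀ z ∈ S, ∀ ε' : ℝ, 0 < ε' → ∀ M : ℝ, ∃ ε : ℝ, 0 < ε ∧ ∀ᶠ n : ℕ in atTop, ∀ x ∈ Gm S,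
    n1Z x ≤ M * n → ∀ k : ℕ, (k : ℝ) ≤ ε * n → b x (x + k • z) ≤ ε' * n

section
variable {S : Finset (Zd d)} {b : Zd d → Zd d → ℝ} (hb : DB S b)
include hb

lemma DB.H' (S0 : Finset (Zd d)) : S0 ⊆ S → ∀ ε' : ℝ, 0 < ε' → ∀ M : ℝ, ∃ ε : ℝ, 0 < ε ∧
    ∀ᶠ n : ℕ in atTop, ∀ x ∈ Gm S, n1Z x ≤ M * n → ∀ k : Zd d → ℕ, (∀ z ∈ S0, (k z : ℝ) ≤ ε * n) →
      b x (x + ∑ z ∈ S0, k z • z) ≤ ε' * n := by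
  induction S0 using Finset.induction_on with
  | empty =>
    intro _ ε' hε' M
    refine ⟨1, one_pos, Eventually.of_forall fun n x _ _ k _ => ?_⟩
    simp only [Finset.sum_empty, add_zero, hb.self]; positivity
  | insert z S0 hz ih =>
    intro hS ε' hε' M
    have hzS : z ∈ S := hS (Finset.mem_insert_self _ _)
    have hS0 : S0 ⊆ S := fun w hw => hS (Finset.mem_insert_of_mem hw)
    obtain ⟨ε1, h1, e1⟩ := ih hS0 (ε'/2) (by linarith) M
    obtain ⟨ε2, h2, e2⟩ := hb.H z hzS (ε'/2) (by linarith) (M + ∑ w ∈ S0, n1Z w)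
    refine ⟨min 1 (min ε1 ε2), by positivity, ?_⟩
    filter_upwards [e1, e2] with n e1 e2 x hx hxM k hk
    have hn : (0:ℝ) ≤ n := by positivity
    have l1 : min 1 (min ε1 ε2) * n ≤ 1 * n := by gcongr; exact min_le_left _ _
    have l2 : min 1 (min ε1 ε2) * n ≤ ε1 * n := by gcongr; exact (min_le_right _ _).trans (min_le_left _ _)
    have l3 : min 1 (min ε1 ε2) * n ≤ ε2 * n := by gcongr; exact (min_le_right _ _).trans (min_le_right _ _)
    have hk0 : ∀ w ∈ S0, (k w : ℝ) ≤ min 1 (min ε1 ε2) * n := fun w hw => hk w (Finset.mem_insert_of_mem hw)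
    have hmem : ∑ w ∈ S0, k w • w ∈ Gm S :=
      sum_mem fun w hw => nsmul_mem (AddSubmonoid.subset_closure (hS0 hw)) _
    have hmz : k z • z ∈ Gm S := nsmul_mem (AddSubmonoid.subset_closure hzS) _
    have a1 := e1 x hx hxM k fun w hw => (hk0 w hw).trans l2
    have hnorm : n1Z (x + ∑ w ∈ S0, k w • w) ≤ (M + ∑ w ∈ S0, n1Z w) * n := by
      calc _ ≤ n1Z x + ∑ w ∈ S0, n1Z (k w • w) := (n1Z_add_le _ _).trans (by gcongr; exact n1Z_sum_le _ _)
        _ ≤ M * n + ∑ w ∈ S0, n1Z w * n := by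
          gcongr with w hw
          rw [n1Z_nsmul, mul_comm]
          have := n1Z_nonneg w
          have := (hk0 w hw).trans l1
          exact mul_le_mul_of_nonneg_left (by linarith) (n1Z_nonneg w)
        _ = _ := by rw [← Finset.sum_mul]; ring
    have a2 := e2 _ (add_mem hx hmem) hnorm (k z) ((hk z (Finset.mem_insert_self _ _)).trans l3)
    rw [Finset.sum_insert hz, add_comm (k z • z)]
    have := hb.sub x _ _ hmem hmz
    rw [← add_assoc] at this ⊢
    linarith

end

lemma floor_tend (a : ℝ) (ha : 0 ≤ a) : Tendsto (fun n : ℕ => (⌊a * (n:ℝ)⌋₊ : ℝ) / n) atTop (𝓝 a) :=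
  (tendsto_nat_floor_mul_div_atTop ha).comp tendsto_natCast_atTop_atTop

lemma lattice_pos (S : Finset (Zd d)) (g : ℕ → Zd d) (hg : ∀ n, g n ∈ AddSubgroup.closure (S : Set (Zd d)))
    (c : Zd d → ℝ) (ε : ℝ) (hc : ∀ z ∈ S, 0 < c z ∧ c z < ε)
    (ht : Tendsto (fun n : ℕ => (n:ℝ)⁻¹ • toR (g n)) atTop (𝓝 (∑ z ∈ S, c z • toR z))) :
    ∀ᶠ n : ℕ in atTop, ∃ k : Zd d → ℕ, g n = ∑ z ∈ S, k z • z ∧ ∀ z ∈ S, (k z : ℝ) ≤ ε * n := by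
  obtain ⟨K, hK, hlat⟩ := lattice_bound S
  set h : ℕ → Zd d := fun n => g n - ∑ z ∈ S, ⌊c z * (n:ℝ)⌋₊ • z with hh
  have hmem : ∀ n, h n ∈ AddSubgroup.closure (S : Set (Zd d)) := fun n =>
    sub_mem (hg n) (sum_mem fun z hz => nsmul_mem (AddSubgroup.subset_closure hz) _)
  have h1 : Tendsto (fun n : ℕ => (n:ℝ)⁻¹ • toR (h n)) atTop (𝓝 0) := by
    have : Tendsto (fun n : ℕ => (n:ℝ)⁻¹ • toR (g n) - ∑ z ∈ S, ((⌊c z * (n:ℝ)⌋₊ : ℝ) / n) • toR z) atTop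
        (𝓝 (∑ z ∈ S, c z • toR z - ∑ z ∈ S, c z • toR z)) := by
      apply ht.sub
      apply tendsto_finsetSum
      intro z hz
      exact (floor_tend _ (hc z hz).1.le).smul_const _
    rw [sub_self] at this
    refine this.congr fun n => ?_
    simp only [hh, toR_sub, toR_sum, toR_nsmul, smul_sub, Finset.smul_sum, smul_smul]
    congr 1
    apply Finset.sum_congr rfl; intro z _; congr 1; ring
  have h2 : Tendsto (fun n : ℕ => K * (n1Z (h n) / n)) atTop (𝓝 0) := by
    have := ((n1_cont.tendsto 0).comp h1).const_mul K
    have h0 : n1 (0 : Fin d → ℝ) = 0 := by simp [n1]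
    rw [h0, mul_zero] at this
    refine this.congr fun n => ?_
    simp only [Function.comp, n1_smul, n1Z]
    rw [abs_of_nonneg (by positivity)]; ring
  have h3 : ∀ z ∈ S, ∀ᶠ n : ℕ in atTop, K * n1Z (h n) ≤ ⌊c z * (n:ℝ)⌋₊ ∧ ⌊c z * (n:ℝ)⌋₊ + K * n1Z (h n) ≤ ε * n := by
    intro z hz
    have hf := floor_tend _ (hc z hz).1.le
    have e1 := (h2.sub hf).eventually (gt_mem_nhds (show 0 - c z < 0 by linarith [(hc z hz).1]))
    have e2 := (hf.add h2).eventually (gt_mem_nhds (show c z + 0 < ε by linarith [(hc z hz).2]))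
    filter_upwards [e1, e2, eventually_gt_atTop 0] with n e1 e2 hn
    have hn' : (0:ℝ) < n := by exact_mod_cast hn
    rw [← mul_div_assoc, ← sub_div, div_neg_iff] at e1
    rw [← mul_div_assoc, ← add_div, div_lt_iff₀ hn'] at e2
    refine ⟨?_, e2.le⟩
    rcases e1 with e1 | e1 <;> linarith [e1.1, e1.2]
  have h4 : ∀ᶠ n : ℕ in atTop, ∀ z ∈ S, K * n1Z (h n) ≤ ⌊c z * (n:ℝ)⌋₊ ∧ ⌊c z * (n:ℝ)⌋₊ + K * n1Z (h n) ≤ ε * n :=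
    (Finset.eventually_all S).2 h3
  filter_upwards [h4] with n h4
  obtain ⟨k, hk, hkb⟩ := hlat (h n) (hmem n)
  have hpos : ∀ z ∈ S, 0 ≤ (⌊c z * (n:ℝ)⌋₊ : ℤ) + k z := by
    intro z hz
    have := (h4 z hz).1; have h5 := abs_le.1 (hkb z)
    have : (0:ℝ) ≤ (⌊c z * (n:ℝ)⌋₊ : ℝ) + k z := by linarith [h5.1]
    exact_mod_cast this
  refine ⟨fun z => ((⌊c z * (n:ℝ)⌋₊ : ℤ) + k z).toNat, ?_, ?_⟩
  · have : g n = h n + ∑ z ∈ S, ⌊c z * (n:ℝ)⌋₊ • z := by simp [hh]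
    rw [this, hk, ← Finset.sum_add_distrib]
    apply Finset.sum_congr rfl
    intro z hz
    rw [← natCast_zsmul _ (Int.toNat _), Int.toNat_of_nonneg (hpos z hz), add_smul, add_comm, natCast_zsmul]
  · intro z hz
    have : (((((⌊c z * (n:ℝ)⌋₊ : ℤ) + k z).toNat : ℤ)) : ℝ) = (⌊c z * (n:ℝ)⌋₊ : ℝ) + k z := by
      rw [Int.toNat_of_nonneg (hpos z hz)]; push_cast; rfl
    have h6 : ((((⌊c z * (n:ℝ)⌋₊ : ℤ) + k z).toNat : ℕ) : ℝ) = (⌊c z * (n:ℝ)⌋₊ : ℝ) + k z := by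
      rw [← this]; norm_cast
    rw [h6]
    linarith [(h4 z hz).2, (abs_le.1 (hkb z)).2]

lemma Gm_le_group (S : Finset (Zd d)) {x : Zd d} (hx : x ∈ Gm S) : x ∈ AddSubgroup.closure (S : Set (Zd d)) :=
  AddSubmonoid.closure_le (S := (AddSubgroup.closure (S : Set (Zd d))).toAddSubmonoid).2
    AddSubgroup.subset_closure hx

section
variable {S : Finset (Zd d)} {b : Zd d → Zd d → ℝ} (hb : DB S b)
include hb

lemma DB.sub0 {x y : Zd d} (hx : x ∈ Gm S) (hy : y ∈ Gm S) : b 0 (x + y) ≤ b 0 x + b x (x + y) := by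
  have := hb.sub 0 x y hx hy
  simpa using this
lemma DB.nn0 {x : Zd d} (hx : x ∈ Gm S) : 0 ≤ b 0 x := by
  have := hb.nn 0 x hx
  simpa using this

lemma DB.CL (M ε' : ℝ) (hε' : 0 < ε') : ∃ ε : ℝ, 0 < ε ∧ ∀ (u v : ℕ → Zd d) (η η' : Fin d → ℝ) (c : Zd d → ℝ),
    (∀ n, u n ∈ Gm S) → (∀ n, v n ∈ Gm S) →
    Tendsto (fun n : ℕ => (n:ℝ)⁻¹ • toR (u n)) atTop (𝓝 η) → n1 η < M →
    Tendsto (fun n : ℕ => (n:ℝ)⁻¹ • toR (v n)) atTop (𝓝 η') →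
    η' = η + ∑ z ∈ S, c z • toR z → (∀ z ∈ S, 0 < c z ∧ c z < ε) →
    ∀ᶠ n : ℕ in atTop, b 0 (v n) ≤ b 0 (u n) + ε' * n := by
  obtain ⟨ε, hε, e⟩ := hb.H' S subset_rfl ε' hε' M
  refine ⟨ε, hε, fun u v η η' c hu hv hut hη hvt he hc => ?_⟩
  have hl := lattice_pos S (fun n => v n - u n) (fun n => sub_mem (Gm_le_group S (hv n)) (Gm_le_group S (hu n)))
    c ε hc (by
      have := hvt.sub hut
      rw [he, add_sub_cancel_left] at this
      refine this.congr fun n => ?_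
      rw [toR_sub, smul_sub])
  have hM := ((n1_cont.tendsto η).comp hut).eventually (gt_mem_nhds hη)
  filter_upwards [hl, hM, e, eventually_gt_atTop 0] with n ⟨k, hk, hkb⟩ hM e hn
  have hn' : (0:ℝ) < n := by exact_mod_cast hn
  have h1 : n1Z (u n) ≤ M * n := by
    simp only [Function.comp, n1_smul] at hM
    rw [abs_of_pos (by positivity), inv_mul_lt_iff₀ hn'] at hM
    rw [n1Z]; linarith
  have h2 := e (u n) (hu n) h1 k hkb
  have h3 : v n = u n + ∑ z ∈ S, k z • z := by rw [← hk]; abel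
  have h4 := hb.sub0 (hu n) (y := ∑ z ∈ S, k z • z)
    (sum_mem fun w hw => nsmul_mem (AddSubmonoid.subset_closure hw) _)
  rw [h3]; linarith

variable {β : Zd d → ℝ} (hβ : ∀ y ∈ Gm S, Tendsto (fun n : ℕ => b 0 (n • y) / n) atTop (𝓝 (β y)))
include hβ

lemma DB.β_nonneg {y : Zd d} (hy : y ∈ Gm S) : 0 ≤ β y :=
  ge_of_tendsto' (hβ y hy) fun n => div_nonneg (hb.nn0 (nsmul_mem hy n)) (by positivity)

omit hb in
lemma DB.β_floor {y : Zd d} (hy : y ∈ Gm S) (s : ℝ) (hs : 0 < s) :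
    Tendsto (fun n : ℕ => b 0 (⌊s * (n:ℝ)⌋₊ • y) / n) atTop (𝓝 (s * β y)) := by
  have h1 : Tendsto (fun n : ℕ => ⌊s * (n:ℝ)⌋₊) atTop atTop :=
    tendsto_nat_floor_atTop.comp (tendsto_natCast_atTop_atTop.const_mul_atTop hs)
  have h2 := (floor_tend s hs.le).mul ((hβ y hy).comp h1)
  refine h2.congr' ?_
  filter_upwards [h1.eventually_gt_atTop 0] with n hn
  have : (⌊s * (n:ℝ)⌋₊ : ℝ) ≠ 0 := by exact_mod_cast hn.ne'
  simp only [Function.comp]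
  rw [div_mul_div_comm, mul_comm (n:ℝ), mul_div_mul_left _ _ this]

omit hb hβ in
lemma toR_floor (y : Zd d) (s : ℝ) (hs : 0 < s) :
    Tendsto (fun n : ℕ => (n:ℝ)⁻¹ • toR (⌊s * (n:ℝ)⌋₊ • y)) atTop (𝓝 (s • toR y)) := by
  refine ((floor_tend s hs.le).smul_const (toR y)).congr fun n => ?_
  rw [toR_nsmul, smul_smul, div_eq_inv_mul]

def AppOK (S : Finset (Zd d)) (γ : Zd d → ℝ) (t : ℝ) (k : Zd d → ℕ) (N : ℕ) : Prop :=
  0 < N ∧ ∀ z ∈ S, (k z : ℝ) < N * γ z ∧ N * γ z < (1 + t) * k z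

lemma DB.AL (γ : Zd d → ℝ) (hγ : ∀ z ∈ S, 0 < γ z) (ε' : ℝ) (hε' : 0 < ε') : ∃ t : ℝ, 0 < t ∧
    ∀ t' ≤ t, 0 < t' → ∀ k N, AppOK S γ t' k N → ∀ x : ℕ → Zd d, (∀ n, x n ∈ Gm S) →
    Tendsto (fun n : ℕ => (n:ℝ)⁻¹ • toR (x n)) atTop (𝓝 (∑ z ∈ S, γ z • toR z)) →
    ∀ᶠ n : ℕ in atTop, |b 0 (x n) / n - β (∑ z ∈ S, k z • z) / N| ≤ ε' := by
  have hγs : 0 ≤ ∑ z ∈ S, γ z := Finset.sum_nonneg fun z hz => (hγ z hz).le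
  have hns : 0 ≤ ∑ z ∈ S, γ z * n1Z z := Finset.sum_nonneg fun z hz => mul_nonneg (hγ z hz).le (n1Z_nonneg z)
  obtain ⟨ε, hε, hCL⟩ := hb.CL (1 + ∑ z ∈ S, γ z * n1Z z) (ε'/2) (by linarith)
  refine ⟨ε / (1 + ∑ z ∈ S, γ z), by positivity, fun t htt ht k N ⟨hN, hk⟩ x hx hxt => ?_⟩
  have htγ : ∀ z ∈ S, t * γ z ≤ ε := by
    intro z hz
    have h1 : γ z ≤ ∑ z ∈ S, γ z := Finset.single_le_sum (f := γ) (fun z hz => (hγ z hz).le) hz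
    rw [le_div_iff₀ (by positivity)] at htt
    nlinarith
  have hN' : (0:ℝ) < N := by exact_mod_cast hN
  set y := ∑ z ∈ S, k z • z with hy
  have hyG : y ∈ Gm S := sum_mem fun w hw => nsmul_mem (AddSubmonoid.subset_closure hw) _
  have hyR : ∀ s : ℝ, s • toR y = ∑ z ∈ S, (s * k z) • toR z := by
    intro s; rw [hy, toR_sum, Finset.smul_sum]; simp only [toR_nsmul, smul_smul]
  have hbd : ∀ c : Zd d → ℝ, (∀ z ∈ S, 0 ≤ c z ∧ c z ≤ γ z) → n1 (∑ z ∈ S, c z • toR z) < 1 + ∑ z ∈ S, γ z * n1Z z := by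
    intro c hc
    have : n1 (∑ z ∈ S, c z • toR z) ≤ ∑ z ∈ S, γ z * n1Z z := by
      refine (n1_sum_le _ _).trans (Finset.sum_le_sum fun z hz => ?_)
      rw [n1_smul, abs_of_nonneg (hc z hz).1]
      exact mul_le_mul_of_nonneg_right (hc z hz).2 (n1Z_nonneg z)
    linarith
  have hk1 : ∀ z ∈ S, (1/N:ℝ) * k z < γ z := by
    intro z hz; rw [one_div, inv_mul_lt_iff₀ hN']; exact (hk z hz).1
  have hk2 : ∀ z ∈ S, γ z < ((1+t)/N:ℝ) * k z := by
    intro z hz; rw [div_mul_eq_mul_div, lt_div_iff₀ hN', mul_comm]; exact (hk z hz).2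
  have hk3 : ∀ z ∈ S, ((1+t)/N:ℝ) * k z - 1/N * k z < ε := by
    intro z hz
    have : ((1+t)/N:ℝ) * k z - 1/N * k z = t * (1/N * k z) := by field_simp; ring
    rw [this]
    exact (mul_lt_mul_of_pos_left (hk1 z hz) ht).trans_le (htγ z hz)
  have s1 : (0:ℝ) < 1/N := by positivity
  have s2 : (0:ℝ) < (1+t)/N := by positivity
  have c1 := hCL (fun n => ⌊(1/N:ℝ) * n⌋₊ • y) x _ _ (fun z => γ z - (1/N) * k z)
    (fun n => nsmul_mem hyG _) hx (toR_floor y _ s1) (by rw [hyR]; exact hbd _ fun z hz => ⟨by positivity, (hk1 z hz).le⟩)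
    hxt (by rw [hyR, ← Finset.sum_add_distrib]; apply Finset.sum_congr rfl; intro z _; rw [← add_smul]; congr 1; ring)
    (fun z hz => ⟨by linarith [hk1 z hz], by linarith [hk2 z hz, hk3 z hz]⟩)
  have c2 := hCL x (fun n => ⌊((1+t)/N:ℝ) * n⌋₊ • y) _ _ (fun z => ((1+t)/N) * k z - γ z)
    hx (fun n => nsmul_mem hyG _) hxt (hbd _ fun z hz => ⟨(hγ z hz).le, le_rfl⟩) (toR_floor y _ s2)
    (by rw [hyR, ← Finset.sum_add_distrib]; apply Finset.sum_congr rfl; intro z _; rw [← add_smul]; congr 1; ring)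
    (fun z hz => ⟨by linarith [hk2 z hz], by linarith [hk1 z hz, hk3 z hz]⟩)
  have f1 := (DB.β_floor hβ hyG _ s1).eventually (gt_mem_nhds (show 1/N * β y < 1/N * β y + ε'/2 by linarith))
  have f2 := (DB.β_floor hβ hyG _ s2).eventually (lt_mem_nhds (show (1+t)/N * β y - ε'/2 < (1+t)/N * β y by linarith))
  filter_upwards [c1, c2, f1, f2, eventually_gt_atTop 0] with n c1 c2 f1 f2 hn
  have hn' : (0:ℝ) < n := by exact_mod_cast hn
  have hβ0 := hb.β_nonneg hβ hyG
  rw [div_lt_iff₀ hn'] at f1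
  rw [lt_div_iff₀ hn'] at f2
  have g1 : b 0 (x n) / n ≤ 1/N * β y + ε' := by
    rw [div_le_iff₀ hn']; linarith
  have g2 : (1+t)/N * β y - ε' ≤ b 0 (x n) / n := by
    rw [le_div_iff₀ hn']; linarith
  have g3 : (1+t)/N * β y = 1/N * β y + t/N * β y := by ring
  have g4 : 0 ≤ t/N * β y := by positivity
  have g5 : β y / N = 1/N * β y := by ring
  rw [abs_le, g5]
  constructor <;> linarith

omit hb hβ in
lemma app_exists (γ : Zd d → ℝ) (hγ : ∀ z ∈ S, 0 < γ z) (t : ℝ) (ht : 0 < t) :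
    ∀ᶠ N : ℕ in atTop, ∃ k, AppOK S γ t k N := by
  have h : ∀ z ∈ S, ∀ᶠ N : ℕ in atTop, 1 + t < t * (N * γ z) := by
    intro z hz
    have : Tendsto (fun N : ℕ => t * ((N:ℝ) * γ z)) atTop atTop :=
      (tendsto_natCast_atTop_atTop.atTop_mul_const (hγ z hz)).const_mul_atTop ht
    exact this.eventually_gt_atTop _
  filter_upwards [(Finset.eventually_all S).2 h, eventually_gt_atTop 0] with N h hN
  refine ⟨fun z => ⌈(N:ℝ) * γ z⌉₊ - 1, hN, fun z hz => ?_⟩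
  have hN' : (0:ℝ) < N := by exact_mod_cast hN
  have hpos : 0 < (N:ℝ) * γ z := mul_pos hN' (hγ z hz)
  have h1 : 1 ≤ ⌈(N:ℝ) * γ z⌉₊ := Nat.one_le_ceil_iff.2 hpos
  have h2 := Nat.ceil_lt_add_one hpos.le
  have h3 := Nat.le_ceil ((N:ℝ) * γ z)
  push_cast [Nat.cast_sub h1]
  have := h z hz
  constructor
  · linarith
  · nlinarith

/-- floor approximating sequence -/
def xh (S : Finset (Zd d)) (γ : Zd d → ℝ) (n : ℕ) : Zd d := ∑ z ∈ S, ⌊γ z * (n:ℝ)⌋₊ • z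

omit hb hβ in
lemma xh_mem (γ : Zd d → ℝ) (n : ℕ) : xh S γ n ∈ Gm S :=
  sum_mem fun w hw => nsmul_mem (AddSubmonoid.subset_closure hw) _

omit hb hβ in
lemma xh_tend (γ : Zd d → ℝ) (hγ : ∀ z ∈ S, 0 < γ z) :
    Tendsto (fun n : ℕ => (n:ℝ)⁻¹ • toR (xh S γ n)) atTop (𝓝 (∑ z ∈ S, γ z • toR z)) := by
  have : Tendsto (fun n : ℕ => ∑ z ∈ S, (n:ℝ)⁻¹ • toR (⌊γ z * (n:ℝ)⌋₊ • z)) atTop (𝓝 (∑ z ∈ S, γ z • toR z)) :=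
    tendsto_finsetSum _ fun z hz => toR_floor z _ (hγ z hz)
  refine this.congr fun n => ?_
  rw [xh, toR_sum, Finset.smul_sum]

lemma DB.conv {ξ : Fin d → ℝ} (hξ : ξ ∈ Pp S) : ∃ L : ℝ, ∀ x : ℕ → Zd d, (∀ n, x n ∈ Gm S) →
    Tendsto (fun n : ℕ => (n:ℝ)⁻¹ • toR (x n)) atTop (𝓝 ξ) →
    Tendsto (fun n : ℕ => b 0 (x n) / n) atTop (𝓝 L) := by
  obtain ⟨γ, hγ, rfl⟩ := hξ
  have key : ∀ ε' : ℝ, 0 < ε' → ∃ q : ℝ, ∀ x : ℕ → Zd d, (∀ n, x n ∈ Gm S) →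
    Tendsto (fun n : ℕ => (n:ℝ)⁻¹ • toR (x n)) atTop (𝓝 (∑ z ∈ S, γ z • toR z)) →
    ∀ᶠ n : ℕ in atTop, |b 0 (x n) / n - q| ≤ ε' := by
    intro ε' hε'
    obtain ⟨t, ht, h⟩ := hb.AL hβ γ hγ ε' hε'
    obtain ⟨N, k, hk⟩ := (app_exists γ hγ t ht).exists
    exact ⟨_, h t le_rfl ht k N hk⟩
  have hc : CauchySeq (fun n : ℕ => b 0 (xh S γ n) / n) := by
    rw [Metric.cauchySeq_iff']
    intro ε hε
    obtain ⟨q, hq⟩ := key (ε/4) (by linarith)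
    obtain ⟨N, hN⟩ := eventually_atTop.1 (hq _ (xh_mem γ) (xh_tend γ hγ))
    refine ⟨N, fun n hn => ?_⟩
    have h1 := abs_le.1 (hN n hn); have h2 := abs_le.1 (hN N le_rfl)
    rw [Real.dist_eq, abs_lt]
    constructor <;> linarith [h1.1, h1.2, h2.1, h2.2]
  obtain ⟨L, hL⟩ := cauchySeq_tendsto_of_complete hc
  refine ⟨L, fun x hx hxt => ?_⟩
  rw [Metric.tendsto_nhds]
  intro ε hε
  obtain ⟨q, hq⟩ := key (ε/4) (by linarith)
  have h3 : |L - q| ≤ ε/4 := le_of_tendsto (hL.sub_const q).abs (hq _ (xh_mem γ) (xh_tend γ hγ))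
  filter_upwards [hq x hx hxt] with n hn
  have h1 := abs_le.1 hn; have h2 := abs_le.1 h3
  rw [Real.dist_eq, abs_lt]
  constructor <;> linarith [h1.1, h1.2, h2.1, h2.2]

lemma DB.subadd (hβs : ∀ y ∈ Gm S, ∀ y' ∈ Gm S, toR y' ∈ Pp S → β (y + y') ≤ β y + β y')
    {ξ ζ : Fin d → ℝ} (hξ : ξ ∈ Pp S) (hζ : ζ ∈ Pp S) (x x' x'' : ℕ → Zd d) (hx : ∀ n, x n ∈ Gm S)
    (hx' : ∀ n, x' n ∈ Gm S) (hx'' : ∀ n, x'' n ∈ Gm S)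
    (ht : Tendsto (fun n : ℕ => (n:ℝ)⁻¹ • toR (x n)) atTop (𝓝 ξ))
    (ht' : Tendsto (fun n : ℕ => (n:ℝ)⁻¹ • toR (x' n)) atTop (𝓝 ζ))
    (ht'' : Tendsto (fun n : ℕ => (n:ℝ)⁻¹ • toR (x'' n)) atTop (𝓝 (ξ + ζ)))
    {L L' L'' : ℝ} (hL : Tendsto (fun n : ℕ => b 0 (x n) / n) atTop (𝓝 L))
    (hL' : Tendsto (fun n : ℕ => b 0 (x' n) / n) atTop (𝓝 L'))
    (hL'' : Tendsto (fun n : ℕ => b 0 (x'' n) / n) atTop (𝓝 L'')) : L'' ≤ L + L' := by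
  obtain ⟨γ, hγ, rfl⟩ := hξ
  obtain ⟨γ', hγ', rfl⟩ := hζ
  have hγ'' : ∀ z ∈ S, 0 < γ z + γ' z := fun z hz => add_pos (hγ z hz) (hγ' z hz)
  apply le_of_forall_pos_le_add
  intro ε hε
  obtain ⟨t1, p1, h1⟩ := hb.AL hβ γ hγ (ε/3) (by linarith)
  obtain ⟨t2, p2, h2⟩ := hb.AL hβ γ' hγ' (ε/3) (by linarith)
  obtain ⟨t3, p3, h3⟩ := hb.AL hβ (fun z => γ z + γ' z) hγ'' (ε/3) (by linarith)
  set t := min t1 (min t2 t3) with hts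
  have ht0 : 0 < t := by positivity
  obtain ⟨N, ⟨k, hk⟩, ⟨k', hk'⟩⟩ := ((app_exists γ hγ t ht0).and (app_exists γ' hγ' t ht0)).exists
  have hk'' : AppOK S (fun z => γ z + γ' z) t (fun z => k z + k' z) N := by
    refine ⟨hk.1, fun z hz => ?_⟩
    have a := hk.2 z hz; have a' := hk'.2 z hz
    push_cast
    constructor <;> nlinarith [a.1, a.2, a'.1, a'.2]
  have e1 := h1 t (min_le_left _ _) ht0 k N hk x hx ht
  have e2 := h2 t ((min_le_right _ _).trans (min_le_left _ _)) ht0 k' N hk' x' hx' ht'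
  have e3 := h3 t ((min_le_right _ _).trans (min_le_right _ _)) ht0 _ N hk'' x'' hx'' (by
    simpa only [add_smul, Finset.sum_add_distrib] using ht'')
  have b1 := abs_le.1 (le_of_tendsto (hL.sub_const _).abs e1)
  have b2 := abs_le.1 (le_of_tendsto (hL'.sub_const _).abs e2)
  have b3 := abs_le.1 (le_of_tendsto (hL''.sub_const _).abs e3)
  have hN : (0:ℝ) < N := by exact_mod_cast hk.1
  have hs := hβs (∑ z ∈ S, k z • z) (sum_mem fun w hw => nsmul_mem (AddSubmonoid.subset_closure hw) _)
    (∑ z ∈ S, k' z • z) (sum_mem fun w hw => nsmul_mem (AddSubmonoid.subset_closure hw) _)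
    ⟨fun z => k' z, fun z hz => by
      have := (hk'.2 z hz).2
      have h0 : 0 < (N:ℝ) * γ' z := mul_pos hN (hγ' z hz)
      have : 0 < (1+t) * (k' z:ℝ) := h0.trans this
      exact (mul_pos_iff_of_pos_left (by linarith)).1 this, by rw [toR_sum]; simp only [toR_nsmul]⟩
  rw [← Finset.sum_add_distrib] at hs
  simp only [← add_smul] at hs
  have hs' := div_le_div_of_nonneg_right hs hN.le
  rw [add_div] at hs'
  linarith [b1.1, b1.2, b2.1, b2.2, b3.1, b3.2]
end
end RWRP

open MeasureTheory Filter Set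
open scoped ENNReal NNReal Classical Topology
noncomputable section
set_option linter.unusedSectionVars false
namespace RWRP
variable {d : ℕ} {Ω : Type*}

section det
variable {T : Zd d → Ω → Ω} {V : Ω → Zd d → ℝ} {p : Zd d → ℝ} {R S : Finset (Zd d)}
  {ℓ : (Fin d → ℝ) →ₗ[ℝ] ℝ} {ω : Ω}

lemma bb_chain (hg : GoodV T V R ℓ ω) (hp : ∀ z ∈ R, 0 < p z) (hp1 : ∑ z ∈ R, p z = 1)
    (x z : Zd d) (hz : z ∈ R) (k : ℕ) :
    bb T V p R ℓ ω x (x + k • z) ≤ ∑ j ∈ Finset.range k, max (V (T (x + j • z) ω) z) 0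
      + k * (|ℓ (toR z)| + |Real.log (p z)|) := by
  induction k with
  | zero => simp [bb_self]
  | succ k ih =>
    have hzm : z ∈ AddSubmonoid.closure (R : Set (Zd d)) := AddSubmonoid.subset_closure hz
    have h1 := bb_sub hg hp hp1 x (k • z) z (nsmul_mem hzm k) hzm
    have h2 := bb_step hg hp hp1 (x + k • z) z hz
    rw [Finset.sum_range_succ, succ_nsmul]
    rw [← add_assoc] at h1 ⊢
    push_cast
    linarith

lemma H_of_class (hg : GoodV T V R ℓ ω) (hp : ∀ z ∈ R, 0 < p z) (hp1 : ∑ z ∈ R, p z = 1)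
    (z : Zd d) (hz : z ∈ R)
    (hcl : (⨅ ε : {e : ℝ // 0 < e},
      Filter.limsup (fun n : ℕ =>
        ⨆ (x : Zd d) (_ : x ∈ Gp S ∧ n1Z x ≤ n),
          (n : ℝ≥0∞)⁻¹ *
            ∑ k ∈ Finset.range (⌊(ε : ℝ) * n⌋₊ + 1), ENNReal.ofReal (max (V (T (x + k • z) ω) z) 0))
        Filter.atTop) = 0) (ε' : ℝ) (hε' : 0 < ε') (M : ℝ) :
    ∃ ε : ℝ, 0 < ε ∧ ∀ᶠ n : ℕ in atTop, ∀ x ∈ Gm S,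
    n1Z x ≤ M * n → ∀ k : ℕ, (k : ℝ) ≤ ε * n → bb T V p R ℓ ω x (x + k • z) ≤ ε' * n := by
  set C := |ℓ (toR z)| + |Real.log (p z)| with hC
  have hC0 : 0 ≤ C := by positivity
  set m : ℕ := ⌈M⌉₊ + 1 with hm
  have hm1 : (1:ℝ) ≤ m := by rw [hm]; push_cast; linarith [Nat.cast_nonneg (α := ℝ) ⌈M⌉₊]
  have hmM : M ≤ m := by rw [hm]; push_cast; linarith [Nat.le_ceil M]
  set δ : ℝ := ε' / (2 * m) with hδ
  have hδ0 : 0 < δ := by positivity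
  have hlt : (⨅ ε : {e : ℝ // 0 < e},
      Filter.limsup (fun n : ℕ =>
        ⨆ (x : Zd d) (_ : x ∈ Gp S ∧ n1Z x ≤ n),
          (n : ℝ≥0∞)⁻¹ *
            ∑ k ∈ Finset.range (⌊(ε : ℝ) * n⌋₊ + 1), ENNReal.ofReal (max (V (T (x + k • z) ω) z) 0))
        Filter.atTop) < ENNReal.ofReal δ := by rw [hcl]; simpa using hδ0
  obtain ⟨⟨ε0, hε0⟩, hl⟩ := iInf_lt_iff.1 hlt
  have hev := eventually_lt_of_limsup_lt hl
  have hmul : Tendsto (fun n : ℕ => m * n) atTop atTop :=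
    tendsto_id.const_mul_atTop' (by rw [hm]; omega)
  have hev2 := hmul.eventually hev
  refine ⟨min ε0 (ε' / (2 * (C + 1))), by positivity, ?_⟩
  filter_upwards [hev2, eventually_gt_atTop 0] with n h hn x hx hxM k hk
  have hn' : (0:ℝ) < n := by exact_mod_cast hn
  have hxm : n1Z x ≤ ((m * n : ℕ) : ℝ) := by
    push_cast
    exact hxM.trans (by gcongr)
  have h1 : ((m * n : ℕ) : ℝ≥0∞)⁻¹ * ∑ k ∈ Finset.range (⌊ε0 * ((m * n : ℕ) : ℝ)⌋₊ + 1),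
      ENNReal.ofReal (max (V (T (x + k • z) ω) z) 0) ≤ ENNReal.ofReal δ := by
    refine le_trans ?_ h.le
    exact le_iSup₂_of_le x ⟨mem_Gp_iff.2 hx, hxm⟩ le_rfl
  have hmn0 : ((m * n : ℕ) : ℝ≥0∞) ≠ 0 := by
    rw [Nat.cast_ne_zero, hm]; positivity
  rw [ENNReal.inv_mul_le_iff hmn0 (ENNReal.natCast_ne_top _), ← ENNReal.ofReal_sum_of_nonneg (fun _ _ => le_max_right _ _),
    ← ENNReal.ofReal_natCast, ← ENNReal.ofReal_mul (by positivity), ENNReal.ofReal_le_ofReal_iff (by positivity)] at h1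
  have h2 : ((m * n : ℕ) : ℝ) * δ = ε' / 2 * n := by
    rw [hδ]; push_cast; field_simp
  have hk1 : (k:ℝ) ≤ ε0 * n := hk.trans (by gcongr; exact min_le_left _ _)
  have hk2 : (k:ℝ) ≤ ε' / (2 * (C + 1)) * n := hk.trans (by gcongr; exact min_le_right _ _)
  have hsub : Finset.range k ⊆ Finset.range (⌊ε0 * ((m * n : ℕ) : ℝ)⌋₊ + 1) := by
    apply Finset.range_subset_range.2
    apply le_trans _ (Nat.le_succ _)
    apply Nat.le_floor
    refine hk1.trans ?_
    push_cast
    gcongr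
    nlinarith
  have h3 := Finset.sum_le_sum_of_subset_of_nonneg (f := fun j => max (V (T (x + j • z) ω) z) 0) hsub
    (fun _ _ _ => le_max_right _ _)
  have h4 := bb_chain hg hp hp1 x z hz k
  have h5 : (k:ℝ) * C ≤ ε' / 2 * n := by
    calc (k:ℝ) * C ≤ (ε' / (2 * (C + 1)) * n) * (C + 1) := by gcongr; linarith
      _ = _ := by field_simp
  rw [← hC] at h4
  linarith

lemma DB_of (hg : GoodV T V R ℓ ω) (hp : ∀ z ∈ R, 0 < p z) (hp1 : ∑ z ∈ R, p z = 1) (hSR : S ⊆ R)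
    (hcl : ∀ z ∈ S, z ≠ 0 → (⨅ ε : {e : ℝ // 0 < e},
      Filter.limsup (fun n : ℕ =>
        ⨆ (x : Zd d) (_ : x ∈ Gp S ∧ n1Z x ≤ n),
          (n : ℝ≥0∞)⁻¹ *
            ∑ k ∈ Finset.range (⌊(ε : ℝ) * n⌋₊ + 1), ENNReal.ofReal (max (V (T (x + k • z) ω) z) 0))
        Filter.atTop) = 0) : DB S (bb T V p R ℓ ω) where
  nn x y hy := bb_nonneg hg hp hp1 x y (AddSubmonoid.closure_mono (by exact_mod_cast hSR) hy)
  sub x y z hy hz := bb_sub hg hp hp1 x y z (AddSubmonoid.closure_mono (by exact_mod_cast hSR) hy)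
    (AddSubmonoid.closure_mono (by exact_mod_cast hSR) hz)
  self := bb_self
  H z hz ε' hε' M := by
    by_cases h0 : z = 0
    · refine ⟨1, one_pos, Eventually.of_forall fun n x _ _ k _ => ?_⟩
      simp only [h0, smul_zero, add_zero, bb_self]; positivity
    · exact H_of_class hg hp hp1 z (hSR hz) (hcl z hz h0) ε' hε' M
end det

section meas
variable [MeasurableSpace Ω] {μ : Measure Ω} [IsProbabilityMeasure μ]
  {T : Zd d → Ω → Ω} {V : Ω → Zd d → ℝ} {p : Zd d → ℝ} {R S : Finset (Zd d)}
  {ℓ : (Fin d → ℝ) →ₗ[ℝ] ℝ}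

lemma ae_good (hTp : ∀ z : Zd d, MeasurePreserving (T z) μ μ)
    (h : ∀ z ∈ R, ∀ᵐ ω ∂μ, 0 ≤ V ω z + ℓ (toR z)) : ∀ᵐ ω ∂μ, GoodV T V R ℓ ω := by
  have h1 : ∀ᵐ ω ∂μ, ∀ z ∈ R, 0 ≤ V ω z + ℓ (toR z) := (Finset.eventually_all R).2 h
  exact ae_all_iff.2 fun x => (hTp x).quasiMeasurePreserving.ae h1

lemma bb_meas (hTm : ∀ z : Zd d, Measurable (T z)) (hV : ∀ z : Zd d, Measurable fun ω => V ω z) (x y : Zd d) :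
    Measurable fun ω => bb T V p R ℓ ω x y := by
  unfold bb
  exact (aFun_meas hTm hV x y).add_const _

lemma T_iter (h0 : T 0 = id) (hT : ∀ x y : Zd d, T (x + y) = T x ∘ T y) (y : Zd d) (m : ℕ) :
    (T y)^[m] = T (m • y) := by
  induction m with
  | zero => simp [h0]
  | succ m ih => rw [Function.iterate_succ, ih, succ_nsmul, hT]

lemma bb_int (hTm : ∀ z : Zd d, Measurable (T z)) (hV : ∀ z : Zd d, Measurable fun ω => V ω z)
    (h0 : T 0 = id) (hT : ∀ x y : Zd d, T (x + y) = T x ∘ T y) (hTp : ∀ z : Zd d, MeasurePreserving (T z) μ μ)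
    (hp : ∀ z ∈ R, 0 < p z) (hp1 : ∑ z ∈ R, p z = 1) (hV1 : VplusL1 μ V R)
    (hg : ∀ᵐ ω ∂μ, GoodV T V R ℓ ω) (y : Zd d) (hy : y ∈ Gm R) :
    ∫⁻ ω, ENNReal.ofReal (bb T V p R ℓ ω 0 y) ∂μ ≠ ∞ := by
  induction hy using AddSubmonoid.closure_induction with
  | mem z hz =>
    have hI : Integrable (fun ω => max (V ω z) 0 + (|ℓ (toR z)| + |Real.log (p z)|)) μ :=
      (hV1 z hz).add (integrable_const _)
    have := hI.lintegral_lt_top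
    refine ((lintegral_mono_ae ?_).trans_lt this).ne
    filter_upwards [hg] with ω hg
    apply ENNReal.ofReal_le_ofReal
    have := bb_step hg hp hp1 0 z hz
    rw [h0] at this
    simpa using this
  | zero => simp [bb_self]
  | add x y hx hy ihx ihy =>
    have h1 : ∫⁻ ω, ENNReal.ofReal (bb T V p R ℓ ω 0 (x+y)) ∂μ ≤
        ∫⁻ ω, (ENNReal.ofReal (bb T V p R ℓ ω 0 x) + ENNReal.ofReal (bb T V p R ℓ (T x ω) 0 y)) ∂μ := by
      apply lintegral_mono_ae
      filter_upwards [hg] with ω hg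
      rw [← bb_shift hT]
      have := bb_sub hg hp hp1 0 x y hx hy
      simp only [zero_add, add_zero] at this ⊢
      exact (ENNReal.ofReal_le_ofReal this).trans ENNReal.ofReal_add_le
    refine ne_top_of_le_ne_top ?_ h1
    rw [lintegral_add_left (bb_meas hTm hV _ _).ennreal_ofReal]
    rw [(hTp x).lintegral_comp (f := fun ω => ENNReal.ofReal (bb T V p R ℓ ω 0 y)) (bb_meas hTm hV _ _).ennreal_ofReal]
    exact ENNReal.add_ne_top.2 ⟨ihx, ihy⟩

/-- the liminf along multiples of a point -/
def BB (T : Zd d → Ω → Ω) (V : Ω → Zd d → ℝ) (p : Zd d → ℝ) (R : Finset (Zd d))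
    (ℓ : (Fin d → ℝ) →ₗ[ℝ] ℝ) (y : Zd d) (ω : Ω) : ℝ≥0∞ :=
  RWRPerg.Fl (fun n ω => ENNReal.ofReal (bb T V p R ℓ ω 0 (n • y))) ω

lemma BB_meas (hTm : ∀ z : Zd d, Measurable (T z)) (hV : ∀ z : Zd d, Measurable fun ω => V ω z) (y : Zd d) :
    Measurable (BB T V p R ℓ y) :=
  RWRPerg.Fl_meas fun _ => (bb_meas hTm hV _ _).ennreal_ofReal

lemma BB_lim (hTm : ∀ z : Zd d, Measurable (T z)) (hV : ∀ z : Zd d, Measurable fun ω => V ω z)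
    (h0 : T 0 = id) (hT : ∀ x y : Zd d, T (x + y) = T x ∘ T y) (hTp : ∀ z : Zd d, MeasurePreserving (T z) μ μ)
    (hp : ∀ z ∈ R, 0 < p z) (hp1 : ∑ z ∈ R, p z = 1) (hV1 : VplusL1 μ V R)
    (hg : ∀ᵐ ω ∂μ, GoodV T V R ℓ ω) (y : Zd d) (hy : y ∈ Gm R) :
    ∀ᵐ ω ∂μ, BB T V p R ℓ y ω ≠ ∞ ∧
      Tendsto (fun n : ℕ => bb T V p R ℓ ω 0 (n • y) / n) atTop (𝓝 (BB T V p R ℓ y ω).toReal) := by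
  have hk := RWRPerg.kingman (hTp y) (f := fun n ω => ENNReal.ofReal (bb T V p R ℓ ω 0 (n • y)))
    (fun _ => (bb_meas hTm hV _ _).ennreal_ofReal) (fun ω => by simp [bb_self])
    (by
      filter_upwards [hg] with ω hg m n
      rw [T_iter h0 hT, ← bb_shift hT]
      have := bb_sub hg hp hp1 0 (m • y) (n • y) (nsmul_mem hy m) (nsmul_mem hy n)
      simp only [zero_add, add_zero, add_smul] at this ⊢
      exact (ENNReal.ofReal_le_ofReal this).trans ENNReal.ofReal_add_le)
    (by simpa using bb_int hTm hV h0 hT hTp hp hp1 hV1 hg y hy)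
  filter_upwards [hk, hg] with ω ⟨hfin, hle⟩ hg
  refine ⟨hfin, ?_⟩
  have ht : Tendsto (fun n : ℕ => ENNReal.ofReal (bb T V p R ℓ ω 0 (n • y)) / n) atTop (𝓝 (BB T V p R ℓ y ω)) :=
    tendsto_of_le_liminf_of_limsup_le le_rfl hle
  have ht2 := (ENNReal.tendsto_toReal hfin).comp ht
  refine ht2.congr fun n => ?_
  have hnn := bb_nonneg hg hp hp1 0 (n • y) (nsmul_mem hy n)
  rw [zero_add] at hnn
  simp only [Function.comp, ENNReal.toReal_div, ENNReal.toReal_natCast, ENNReal.toReal_ofReal hnn]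

lemma in_prob {h : ℕ → Ω → ℝ} {H : Ω → ℝ} {Sn : ℕ → Ω → Ω} (hh : ∀ n, Measurable (h n)) (hH : Measurable H)
    (hlim : ∀ᵐ ω ∂μ, Tendsto (fun n => h n ω) atTop (𝓝 (H ω)))
    (hS : ∀ n, MeasurePreserving (Sn n) μ μ) (hinv : ∀ n, ∀ᵐ ω ∂μ, H (Sn n ω) = H ω) :
    ∃ ns : ℕ → ℕ, StrictMono ns ∧ ∀ᵐ ω ∂μ, Tendsto (fun k => h (ns k) (Sn (ns k) ω)) atTop (𝓝 (H ω)) := by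
  have h1 : TendstoInMeasure μ h atTop H :=
    tendstoInMeasure_of_tendsto_ae (fun n => (hh n).aestronglyMeasurable) hlim
  have h2 : TendstoInMeasure μ (fun n ω => h n (Sn n ω)) atTop H := by
    intro ε hε
    refine (h1 ε hε).congr fun n => ?_
    have hm : MeasurableSet {x | ε ≤ edist (h n x) (H x)} :=
      measurableSet_le measurable_const ((hh n).edist hH)
    rw [← (hS n).measure_preimage hm.nullMeasurableSet]
    apply measure_congr
    filter_upwards [hinv n] with ω hω
    apply propext
    show ε ≤ edist (h n (Sn n ω)) (H (Sn n ω)) ↔ ε ≤ edist (h n (Sn n ω)) (H ω)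
    rw [hω]
  exact h2.exists_seq_tendsto_ae
end meas
end RWRP

open MeasureTheory Filter Set
open scoped ENNReal NNReal Classical Topology
noncomputable section
set_option linter.unusedSectionVars false
namespace RWRP
variable {d : ℕ} {Ω : Type*}

section
variable [MeasurableSpace Ω] {μ : Measure Ω} [IsProbabilityMeasure μ]
  {T : Zd d → Ω → Ω} {V : Ω → Zd d → ℝ} {p : Zd d → ℝ} {R S : Finset (Zd d)}
  {ℓ : (Fin d → ℝ) →ₗ[ℝ] ℝ}

lemma BB_sub (hTm : ∀ z : Zd d, Measurable (T z)) (hV : ∀ z : Zd d, Measurable fun ω => V ω z)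
    (hT : ∀ x y : Zd d, T (x + y) = T x ∘ T y) (hTp : ∀ z : Zd d, MeasurePreserving (T z) μ μ)
    (hDB : ∀ᵐ ω ∂μ, DB S (bb T V p R ℓ ω))
    (hlim : ∀ᵐ ω ∂μ, ∀ y ∈ Gm S, BB T V p R ℓ y ω ≠ ∞ ∧
      Tendsto (fun n : ℕ => bb T V p R ℓ ω 0 (n • y) / n) atTop (𝓝 (BB T V p R ℓ y ω).toReal))
    (y y' : Zd d) (hy : y ∈ Gm S) (hy' : y' ∈ Gm S) (hP : toR y' ∈ Pp S) :
    ∀ᵐ ω ∂μ, (BB T V p R ℓ (y + y') ω).toReal ≤ (BB T V p R ℓ y ω).toReal + (BB T V p R ℓ y' ω).toReal := by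
  have hinv : ∀ w ∈ Gm S, ∀ᵐ ω ∂μ, BB T V p R ℓ y' (T w ω) = BB T V p R ℓ y' ω := by
    intro w hw
    apply RWRPerg.inv_ae (hTp w) (BB_meas hTm hV y')
    filter_upwards [hDB, hlim, (hTp w).quasiMeasurePreserving.ae hlim] with ω hb hl hl'
    rw [← ENNReal.toReal_le_toReal (hl y' hy').1 (hl' y' hy').1]
    obtain ⟨L, hL⟩ := hb.conv (fun y hy => (hl y hy).2) hP
    have hinvn : Tendsto (fun n : ℕ => ((n:ℝ))⁻¹) atTop (𝓝 0) := tendsto_inv_atTop_nhds_zero_nat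
    have e1 : Tendsto (fun n : ℕ => (n:ℝ)⁻¹ • toR (n • y')) atTop (𝓝 (toR y')) := by
      refine tendsto_const_nhds.congr' ?_
      filter_upwards [eventually_gt_atTop 0] with n hn
      have : (n:ℝ) ≠ 0 := by exact_mod_cast hn.ne'
      rw [toR_nsmul, smul_smul, inv_mul_cancel₀ this, one_smul]
    have e2 : Tendsto (fun n : ℕ => (n:ℝ)⁻¹ • toR (w + n • y')) atTop (𝓝 (toR y')) := by
      have := (hinvn.smul_const (toR w)).add e1
      rw [zero_smul, zero_add] at this
      refine this.congr fun n => ?_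
      rw [toR_add, smul_add]
    have l1 := hL _ (fun n => nsmul_mem hy' n) e1
    have l2 := hL _ (fun n => add_mem hw (nsmul_mem hy' n)) e2
    have hLe : L = (BB T V p R ℓ y' ω).toReal := tendsto_nhds_unique l1 (hl y' hy').2
    have l3 := (hinvn.const_mul (bb T V p R ℓ ω 0 w)).add (hl' y' hy').2
    rw [mul_zero, zero_add] at l3
    rw [← hLe]
    refine le_of_tendsto_of_tendsto' l2 l3 fun n => ?_
    have := hb.sub0 hw (nsmul_mem hy' n)
    have h2 : bb T V p R ℓ ω w (w + n • y') = bb T V p R ℓ (T w ω) 0 (n • y') := by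
      rw [← bb_shift hT, add_zero]
    rw [h2] at this
    rw [← div_eq_mul_inv, ← add_div]
    gcongr
  obtain ⟨ns, hns, hsub⟩ := in_prob (μ := μ) (h := fun n ω => bb T V p R ℓ ω 0 (n • y') / n)
    (H := fun ω => (BB T V p R ℓ y' ω).toReal) (Sn := fun n => T (n • y))
    (fun n => (bb_meas hTm hV _ _).div_const _) (BB_meas hTm hV y').ennreal_toReal
    (by filter_upwards [hlim] with ω hl using (hl y' hy').2) (fun n => hTp _)
    (fun n => by filter_upwards [hinv _ (nsmul_mem hy n)] with ω h; rw [h])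
  filter_upwards [hDB, hlim, hsub] with ω hb hl hs
  have l1 := (hl (y + y') (add_mem hy hy')).2.comp hns.tendsto_atTop
  have l2 := (hl y hy).2.comp hns.tendsto_atTop
  refine le_of_tendsto_of_tendsto' l1 (l2.add hs) fun k => ?_
  simp only [Function.comp]
  rw [← add_div]
  have := hb.sub0 (nsmul_mem hy (ns k)) (nsmul_mem hy' (ns k))
  have h2 : bb T V p R ℓ ω (ns k • y) (ns k • y + ns k • y') = bb T V p R ℓ (T (ns k • y) ω) 0 (ns k • y') := by
    rw [← bb_shift hT, add_zero]
  rw [h2, ← smul_add] at this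
  gcongr

/-- chosen coefficients -/
def gsel (S : Finset (Zd d)) (ξ : Fin d → ℝ) : Zd d → ℝ :=
  if h : ξ ∈ Pp S then h.choose else 0

lemma gsel_pos {ξ : Fin d → ℝ} (h : ξ ∈ Pp S) : ∀ z ∈ S, 0 < gsel S ξ z := by
  rw [gsel, dif_pos h]; exact h.choose_spec.1
lemma gsel_eq {ξ : Fin d → ℝ} (h : ξ ∈ Pp S) : ∑ z ∈ S, gsel S ξ z • toR z = ξ := by
  rw [gsel, dif_pos h]; exact h.choose_spec.2.symm

def alph (T : Zd d → Ω → Ω) (V : Ω → Zd d → ℝ) (p : Zd d → ℝ) (R S : Finset (Zd d))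
    (ω : Ω) (ξ : Fin d → ℝ) : ℝ :=
  if ξ = 0 then 0 else limsup (fun n : ℕ => aFun T V p R ω 0 (xh S (gsel S ξ) n) / n) atTop

lemma alph_meas (hTm : ∀ z : Zd d, Measurable (T z)) (hV : ∀ z : Zd d, Measurable fun ω => V ω z)
    (ξ : Fin d → ℝ) : Measurable fun ω => alph T V p R S ω ξ := by
  unfold alph
  split_ifs
  · exact measurable_const
  · exact Measurable.limsup fun n => (aFun_meas hTm hV _ _).div_const _

lemma alph_lim {ω : Ω} (hb : DB S (bb T V p R ℓ ω)) {β : Zd d → ℝ}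
    (hβ : ∀ y ∈ Gm S, Tendsto (fun n : ℕ => bb T V p R ℓ ω 0 (n • y) / n) atTop (𝓝 (β y)))
    {ξ : Fin d → ℝ} (hξ : ξ ∈ Pp S) (x : ℕ → Zd d) (hx : ∀ n, x n ∈ Gm S)
    (hxt : Tendsto (fun n : ℕ => (n:ℝ)⁻¹ • toR (x n)) atTop (𝓝 ξ)) :
    Tendsto (fun n : ℕ => bb T V p R ℓ ω 0 (x n) / n) atTop (𝓝 (alph T V p R S ω ξ + ℓ ξ)) ∧
    Tendsto (fun n : ℕ => aFun T V p R ω 0 (x n) / n) atTop (𝓝 (alph T V p R S ω ξ)) := by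
  obtain ⟨L, hL⟩ := hb.conv hβ hξ
  have hℓ : Continuous ℓ := LinearMap.continuous_of_finiteDimensional ℓ
  have key : ∀ x : ℕ → Zd d, (∀ n, x n ∈ Gm S) →
      Tendsto (fun n : ℕ => (n:ℝ)⁻¹ • toR (x n)) atTop (𝓝 ξ) →
      Tendsto (fun n : ℕ => aFun T V p R ω 0 (x n) / n) atTop (𝓝 (L - ℓ ξ)) := by
    intro x hx hxt
    refine ((hL x hx hxt).sub ((hℓ.tendsto ξ).comp hxt)).congr fun n => ?_
    simp only [Function.comp, map_smul, smul_eq_mul, bb, sub_zero]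
    ring
  have hα : alph T V p R S ω ξ = L - ℓ ξ := by
    unfold alph
    split_ifs with h0
    · have := key (fun _ => 0) (fun _ => zero_mem _) (by
        rw [h0]; simp [toR_zero])
      have h2 : (fun n : ℕ => aFun T V p R ω 0 (0 : Zd d) / n) = fun _ => 0 := by
        ext n; simp [aFun]
      rw [h2] at this
      exact tendsto_nhds_unique tendsto_const_nhds this
    · refine (key _ (xh_mem _) ?_).limsup_eq
      have := xh_tend _ (gsel_pos hξ)
      rwa [gsel_eq hξ] at this
  rw [hα]
  refine ⟨?_, key x hx hxt⟩
  rw [sub_add_cancel]; exact hL x hx hxt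

lemma Pp_add {ξ ζ : Fin d → ℝ} (hξ : ξ ∈ Pp S) (hζ : ζ ∈ Pp S) : ξ + ζ ∈ Pp S := by
  obtain ⟨γ, hγ, rfl⟩ := hξ
  obtain ⟨γ', hγ', rfl⟩ := hζ
  exact ⟨fun z => γ z + γ' z, fun z hz => add_pos (hγ z hz) (hγ' z hz), by
    simp only [add_smul, Finset.sum_add_distrib]⟩

lemma Pp_smul {ξ : Fin d → ℝ} (hξ : ξ ∈ Pp S) (s : ℝ) (hs : 0 < s) : s • ξ ∈ Pp S := by
  obtain ⟨γ, hγ, rfl⟩ := hξ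
  exact ⟨fun z => s * γ z, fun z hz => mul_pos hs (hγ z hz), by
    simp only [Finset.smul_sum, smul_smul]⟩

lemma xh_gsel {ξ : Fin d → ℝ} (hξ : ξ ∈ Pp S) :
    Tendsto (fun n : ℕ => (n:ℝ)⁻¹ • toR (xh S (gsel S ξ) n)) atTop (𝓝 ξ) := by
  have := xh_tend _ (gsel_pos hξ)
  rwa [gsel_eq hξ] at this

lemma alph_hom {ω : Ω} (hb : DB S (bb T V p R ℓ ω)) {β : Zd d → ℝ}
    (hβ : ∀ y ∈ Gm S, Tendsto (fun n : ℕ => bb T V p R ℓ ω 0 (n • y) / n) atTop (𝓝 (β y)))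
    {ξ : Fin d → ℝ} (hξ : ξ ∈ Pp S) (s : ℝ) (hs : 0 ≤ s) :
    alph T V p R S ω (s • ξ) = s * alph T V p R S ω ξ := by
  rcases hs.eq_or_lt with rfl | hs
  · simp [alph]
  set x := xh S (gsel S ξ) with hxd
  have hxt := xh_gsel hξ
  have h1 : Tendsto (fun n : ℕ => ⌊s * (n:ℝ)⌋₊) atTop atTop :=
    tendsto_nat_floor_atTop.comp (tendsto_natCast_atTop_atTop.const_mul_atTop hs)
  have hwt : Tendsto (fun n : ℕ => (n:ℝ)⁻¹ • toR (x ⌊s * (n:ℝ)⌋₊)) atTop (𝓝 (s • ξ)) := by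
    refine ((floor_tend s hs.le).smul (hxt.comp h1)).congr' ?_
    filter_upwards [h1.eventually_gt_atTop 0] with n hn
    have : (⌊s * (n:ℝ)⌋₊ : ℝ) ≠ 0 := by exact_mod_cast hn.ne'
    simp only [Function.comp]
    rw [smul_smul]; congr 1; field_simp
  have l1 := (alph_lim hb hβ (Pp_smul hξ s hs) (fun n => x ⌊s * (n:ℝ)⌋₊) (fun n => xh_mem _ _) hwt).2
  have l2 := (floor_tend s hs.le).mul ((alph_lim hb hβ hξ x (fun n => xh_mem _ _) hxt).2.comp h1)
  refine tendsto_nhds_unique l1 (l2.congr' ?_)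
  filter_upwards [h1.eventually_gt_atTop 0] with n hn
  have : (⌊s * (n:ℝ)⌋₊ : ℝ) ≠ 0 := by exact_mod_cast hn.ne'
  simp only [Function.comp]
  rw [div_mul_div_comm, mul_comm (n:ℝ), mul_div_mul_left _ _ this]
end
end RWRP


open RWRP in
/-- point-to-point limit defining the quenched Lyapunov exponent. -/
theorem statement2
    {d : ℕ} {Ω : Type*} [MeasurableSpace Ω]
    (ℙ : Measure Ω) [IsProbabilityMeasure ℙ]
    (T : Zd d → Ω → Ω) (R : Finset (Zd d)) (V : Ω → Zd d → ℝ) (p : Zd d → ℝ)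
    (hset : Setting ℙ T R V p)
    (hV1 : VplusL1 ℙ V R)
    (U₀ : Set (Fin d → ℝ)) (hU₀ : IsZeroFace R U₀)
    (hi : AssumptionI ℙ V R U₀)
    (A : Set (Fin d → ℝ)) (hA : IsFace (Cp R) A) (hAne : A ≠ {0})
    (R' : Finset (Zd d)) (hR' : ∀ z, z ∈ R' ↔ z ∈ R ∧ toR z ∈ A)
    (hL : ∀ z ∈ R', z ≠ 0 → classL ℙ T (fun ω => max (V ω z) 0) z R')
    (hL0 : ∃ zh ∈ R', zh ≠ 0 ∧ classL ℙ T (fun ω => max (V ω 0) 0) zh R')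
    :
    ∃ α : Ω → (Fin d → ℝ) → ℝ,
      (∀ ξ, Measurable fun ω => α ω ξ) ∧
      ∀ᵐ ω ∂ℙ,
        (∀ s : ℝ, 0 ≤ s → ∀ ξ ∈ intrinsicInterior ℝ A, α ω (s • ξ) = s * α ω ξ) ∧
        (∀ ξ ∈ intrinsicInterior ℝ A, ∀ ζ ∈ intrinsicInterior ℝ A,
          α ω (ξ + ζ) ≤ α ω ξ + α ω ζ) ∧
        (∀ ξ ∈ intrinsicInterior ℝ A, ∀ x : ℕ → Zd d,
          (∀ n, x n ∈ Gp R ∧ toR (x n) ∈ A) →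
          Tendsto (fun n : ℕ => (n : ℝ)⁻¹ • toR (x n)) atTop (𝓝 ξ) →
          Tendsto (fun n : ℕ => aFun T V p R ω 0 (x n) / n) atTop (𝓝 (α ω ξ))) := by
  obtain ⟨hTm, h0, hT, hTp, -, hV, hp', hp1⟩ := hset
  have hp : ∀ z ∈ R, 0 < p z := fun z hz => (hp' z hz).1
  obtain ⟨hi1, c, hi2⟩ := hi
  obtain ⟨ℓ, hℓ0, hℓ1⟩ := exists_functional R U₀ hU₀ (-c)
  have hSR : R' ⊆ R := fun z hz => ((hR' z).1 hz).1
  have hGSR : Gm R' ≤ Gm R := AddSubmonoid.closure_mono (by exact_mod_cast hSR)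
  have hne : A.Nonempty := by
    obtain ⟨zh, hz, -⟩ := hL0
    exact ⟨_, ((hR' zh).1 hz).2⟩
  have hg : ∀ᵐ ω ∂ℙ, GoodV T V R ℓ ω := by
    apply ae_good hTp
    intro z hz
    by_cases hzU : toR z ∈ U₀
    · filter_upwards [hi1 z ⟨hz, hzU⟩] with ω h
      rw [hℓ0 z hz hzU]; linarith
    · filter_upwards [hi2 z hz hzU] with ω h
      linarith [hℓ1 z hz hzU]
  have hcl : ∀ᵐ ω ∂ℙ, ∀ z ∈ R', z ≠ 0 → _ := (Finset.eventually_all R').2 fun z hz => by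
    by_cases hz0 : z = 0
    · exact Eventually.of_forall fun ω h => absurd hz0 h
    · have := hL z hz hz0
      unfold classL at this
      filter_upwards [this] with ω h _ using h
  have hDB : ∀ᵐ ω ∂ℙ, DB R' (bb T V p R ℓ ω) := by
    filter_upwards [hg, hcl] with ω hg hcl
    exact DB_of hg hp hp1 hSR hcl
  have hlim : ∀ᵐ ω ∂ℙ, ∀ y ∈ Gm R', BB T V p R ℓ y ω ≠ ∞ ∧
      Tendsto (fun n : ℕ => bb T V p R ℓ ω 0 (n • y) / n) atTop (𝓝 (BB T V p R ℓ y ω).toReal) := by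
    rw [ae_all_iff]
    intro y
    by_cases hy : y ∈ Gm R'
    · filter_upwards [BB_lim hTm hV h0 hT hTp hp hp1 hV1 hg y (hGSR hy)] with ω h _ using h
    · exact Eventually.of_forall fun ω h => absurd h hy
  have hsub : ∀ᵐ ω ∂ℙ, ∀ y ∈ Gm R', ∀ y' ∈ Gm R', toR y' ∈ Pp R' →
      (BB T V p R ℓ (y + y') ω).toReal ≤ (BB T V p R ℓ y ω).toReal + (BB T V p R ℓ y' ω).toReal := by
    have : ∀ᵐ ω ∂ℙ, ∀ y y', y ∈ Gm R' → y' ∈ Gm R' → toR y' ∈ Pp R' →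
      (BB T V p R ℓ (y + y') ω).toReal ≤ (BB T V p R ℓ y ω).toReal + (BB T V p R ℓ y' ω).toReal := by
      rw [ae_all_iff]
      intro y
      rw [ae_all_iff]
      intro y'
      by_cases hh : y ∈ Gm R' ∧ y' ∈ Gm R' ∧ toR y' ∈ Pp R'
      · filter_upwards [BB_sub hTm hV hT hTp hDB hlim y y' hh.1 hh.2.1 hh.2.2] with ω h _ _ _ using h
      · exact Eventually.of_forall fun ω h1 h2 h3 => absurd ⟨h1, h2, h3⟩ hh
    filter_upwards [this] with ω h y hy y' hy' hP using h y y' hy hy' hP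
  have hrel : intrinsicInterior ℝ A ⊆ Pp R' := relint_sub_Pp hA hne hR'
  refine ⟨alph T V p R R', alph_meas hTm hV, ?_⟩
  filter_upwards [hDB, hlim, hsub] with ω hb hl hs
  have hβ : ∀ y ∈ Gm R', Tendsto (fun n : ℕ => bb T V p R ℓ ω 0 (n • y) / n) atTop
      (𝓝 (BB T V p R ℓ y ω).toReal) := fun y hy => (hl y hy).2
  refine ⟨fun s hs0 ξ hξ => alph_hom hb hβ (hrel hξ) s hs0, ?_, ?_⟩
  · intro ξ hξ ζ hζ
    have k1 := alph_lim hb hβ (hrel hξ) _ (xh_mem _) (xh_gsel (hrel hξ))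
    have k2 := alph_lim hb hβ (hrel hζ) _ (xh_mem _) (xh_gsel (hrel hζ))
    have k3 := alph_lim hb hβ (Pp_add (hrel hξ) (hrel hζ)) _ (xh_mem _) (xh_gsel (Pp_add (hrel hξ) (hrel hζ)))
    have := hb.subadd hβ hs (hrel hξ) (hrel hζ) _ _ _ (xh_mem _) (xh_mem _) (xh_mem _)
      (xh_gsel (hrel hξ)) (xh_gsel (hrel hζ)) (xh_gsel (Pp_add (hrel hξ) (hrel hζ))) k1.1 k2.1 k3.1
    rw [map_add] at this
    linarith
  · intro ξ hξ x hx hxt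
    exact (alph_lim hb hβ (hrel hξ) x (fun n => mem_Gp_iff.1 (Gp_face hA hR' (hx n).1 (hx n).2)) hxt).2
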